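/- arXiv:1512.07289 — 2 statements merged into one kernel-verified Lean document; each statement's English description precedes it below -/
import Mathlib

section
/- Let n ≥ 2 and let K be an origin-symmetric convex body in R^n such that for some r > 0, Π_K(t) = Π_{rB₂ⁿ}(t) for all t ≥ 0, where rB₂ⁿ is the Euclidean ball of radius r centered at the origin. Then K = rB₂ⁿ. -/
open MeasureTheory Metric Set
open scoped RealInnerProductSpace ENNReal NNReal

noncomputable section

/-- Euclidean space `ℝ^n`. -/
abbrev Euc (n : ℕ) := EuclideanSpace ℝ (Fin n)

/-- A convex body: a compact convex set with nonempty interior. -/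
def IsConvexBody {n : ℕ} (K : Set (Euc n)) : Prop :=
  Convex ℝ K ∧ IsCompact K ∧ (interior K).Nonempty

/-- The Haar (rotation invariant) probability measure of a set of directions on the
unit sphere `S^{n-1}`, realized as normalized `(n-1)`-dimensional Hausdorff measure. -/
def sphHaar (n : ℕ) (A : Set (Euc n)) : ℝ≥0∞ :=
  μH[(n : ℝ) - 1] (A ∩ sphere (0 : Euc n) 1) / μH[(n : ℝ) - 1] (sphere (0 : Euc n) 1)

/-- `|K ∩ θ^⊥|`: the `(n-1)`-dimensional Hausdorff measure of the central section of `K`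
perpendicular to `θ`. -/
def sectionVol (n : ℕ) (K : Set (Euc n)) (θ : Euc n) : ℝ≥0∞ :=
  μH[(n : ℝ) - 1] (K ∩ {x : Euc n | ⟪x, θ⟫ = 0})

/-- `S_K(t)`: distribution function of the areas of central hyperplane sections. -/
def Sdist (n : ℕ) (K : Set (Euc n)) (t : ℝ) : ℝ≥0∞ :=
  sphHaar n {θ : Euc n | ENNReal.ofReal t ≤ sectionVol n K θ}

/-- `|K | θ^⊥|`: the `(n-1)`-dimensional Hausdorff measure of the orthogonal projection
of `K` onto the hyperplane `θ^⊥` (for a unit vector `θ`). -/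
def projVol (n : ℕ) (K : Set (Euc n)) (θ : Euc n) : ℝ≥0∞ :=
  μH[(n : ℝ) - 1] ((fun x => x - ⟪x, θ⟫ • θ) '' K)

/-- `Π_K(t)`: distribution function of the volumes of hyperplane projections. -/
def PiDist (n : ℕ) (K : Set (Euc n)) (t : ℝ) : ℝ≥0∞ :=
  sphHaar n {θ : Euc n | ENNReal.ofReal t ≤ projVol n K θ}

/-- The radial function `ρ_K(θ) = max {a ≥ 0 : a • θ ∈ K}`. -/
def radial {n : ℕ} (K : Set (Euc n)) (θ : Euc n) : ℝ :=
  sSup {a : ℝ | 0 ≤ a ∧ a • θ ∈ K}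

/-- The support function `h_K(θ) = sup_{y ∈ K} ⟨θ, y⟩`. -/
def suppFn {n : ℕ} (K : Set (Euc n)) (θ : Euc n) : ℝ :=
  sSup ((fun y => ⟪θ, y⟫) '' K)

/-- The polar body `K° = {x : ⟨x, y⟩ ≤ 1 for all y ∈ K}`. -/
def polarBody {n : ℕ} (K : Set (Euc n)) : Set (Euc n) :=
  {x | ∀ y ∈ K, ⟪x, y⟫ ≤ 1}

section CosineTransform

variable {E F : Type*} [NormedAddCommGroup E] [InnerProductSpace ℝ E] [FiniteDimensional ℝ E]
  [MeasurableSpace E] [BorelSpace E]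
  [NormedAddCommGroup F] [InnerProductSpace ℝ F] [FiniteDimensional ℝ F]
  [MeasurableSpace F] [BorelSpace F]

theorem integrableOn_abs_inner_ball (w : F) :
    IntegrableOn (fun z : F => |⟪z, w⟫|) (ball 0 1) := by
  have h : Continuous fun z : F => |⟪z, w⟫| := by fun_prop
  exact (h.continuousOn.integrableOn_compact (isCompact_closedBall (0 : F) 1)).mono_set
    ball_subset_closedBall

theorem integral_abs_inner_ball_isometry (φ : F ≃ₗᵢ[ℝ] F) (w : F) :
    ∫ z in ball (0 : F) 1, |⟪z, φ w⟫| = ∫ z in ball (0 : F) 1, |⟪z, w⟫| := by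
  have hp : φ ⁻¹' ball (0 : F) 1 = ball 0 1 := by
    ext z; simp
  rw [← φ.measurePreserving.setIntegral_preimage_emb φ.toHomeomorph.measurableEmbedding, hp]
  simp [LinearIsometryEquiv.inner_map_map]

theorem integral_abs_inner_ball_congr {v w : F} (h : ‖v‖ = ‖w‖) :
    ∫ z in ball (0 : F) 1, |⟪z, v⟫| = ∫ z in ball (0 : F) 1, |⟪z, w⟫| := by
  have := integral_abs_inner_ball_isometry ((ℝ ∙ (v - w))ᗮ.reflection) v
  rw [Submodule.reflection_sub h] at this
  exact this.symm

theorem exists_integral_abs_inner_ball_eq [Nontrivial F] :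
    ∃ c : ℝ, 0 < c ∧ ∀ w : F, ∫ z in ball (0 : F) 1, |⟪z, w⟫| = c * ‖w‖ := by
  obtain ⟨e, he⟩ := exists_norm_eq F (zero_le_one : (0 : ℝ) ≤ 1)
  refine ⟨∫ z in ball (0 : F) 1, |⟪z, e⟫|, ?_, fun w => ?_⟩
  · rw [setIntegral_pos_iff_support_of_nonneg_ae (ae_of_all _ fun z => abs_nonneg _)
      (integrableOn_abs_inner_ball e)]
    have h : Continuous fun z : F => |⟪z, e⟫| := by fun_prop
    refine (h.isOpen_support.inter isOpen_ball).measure_pos _ ⟨(1 / 2 : ℝ) • e, ?_, ?_⟩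
    · simp [inner_smul_left, he]
    · simp [norm_smul, he]; norm_num
  · rw [integral_abs_inner_ball_congr (v := w) (w := ‖w‖ • e) (by simp [norm_smul, he]),
      mul_comm, ← integral_const_mul]
    simp [inner_smul_right, abs_mul]

omit [FiniteDimensional ℝ E] [MeasurableSpace F] [BorelSpace F] in
theorem integrable_norm_of_map {μ : Measure E} (hμ : Integrable (fun v : E => ‖v‖) μ)
    (A : E →L[ℝ] F) : Integrable (fun v => ‖A v‖) μ := by
  refine (hμ.const_mul ‖A‖).mono' (by fun_prop) (ae_of_all _ fun v => ?_)
  simpa using A.le_opNorm v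

theorem integral_norm_map_eq {μ₁ μ₂ : Measure E} [IsFiniteMeasure μ₁] [IsFiniteMeasure μ₂]
    (h₁ : Integrable (fun v : E => ‖v‖) μ₁) (h₂ : Integrable (fun v : E => ‖v‖) μ₂)
    (h : ∀ u : E, ∫ v, |⟪u, v⟫| ∂μ₁ = ∫ v, |⟪u, v⟫| ∂μ₂) (A : E →L[ℝ] F) :
    ∫ v, ‖A v‖ ∂μ₁ = ∫ v, ‖A v‖ ∂μ₂ := by
  rcases subsingleton_or_nontrivial F with hF | hF
  · simp [Subsingleton.elim _ (0 : F)]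
  obtain ⟨c, hc, hcw⟩ := exists_integral_abs_inner_ball_eq (F := F)
  have key : ∀ (μ : Measure E) [IsFiniteMeasure μ], Integrable (fun v : E => ‖v‖) μ →
      c * ∫ v, ‖A v‖ ∂μ = ∫ z in ball (0 : F) 1, ∫ v, |⟪A.adjoint z, v⟫| ∂μ := by
    intro μ _ hμ
    rw [← integral_const_mul]
    simp_rw [← hcw, ContinuousLinearMap.adjoint_inner_left]
    refine integral_integral_swap ?_
    have hz : Integrable (fun z : F => ‖z‖) (volume.restrict (ball 0 1)) :=
      ((continuous_norm.continuousOn.integrableOn_compact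
        (isCompact_closedBall (0 : F) 1)).mono_set ball_subset_closedBall)
    refine ((integrable_norm_of_map hμ A).mul_prod hz).mono' ?_ (ae_of_all _ fun p => ?_)
    · exact Continuous.aestronglyMeasurable (by unfold Function.uncurry; fun_prop)
    · simp only [Function.uncurry, Real.norm_eq_abs, abs_abs]
      rw [mul_comm]
      exact abs_real_inner_le_norm _ _
  have := (key μ₁ h₁).trans ((by simp_rw [h] : _ = _).trans (key μ₂ h₂).symm)
  exact mul_left_cancel₀ hc.ne' this

end CosineTransform

section Moments

theorem choose_half_ne_zero (k : ℕ) : Ring.choose (1 / 2 : ℝ) k ≠ 0 := by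
  have h := Ring.descPochhammer_eq_factorial_smul_choose (1 / 2 : ℝ) k
  intro h0
  rw [h0, smul_zero, ← Polynomial.aeval_eq_smeval, ← Polynomial.eval_map_algebraMap,
    descPochhammer_map, descPochhammer_eval_eq_prod_range, Finset.prod_eq_zero_iff] at h
  obtain ⟨j, -, hj⟩ := h
  have : (1 : ℝ) = ((2 * j : ℕ) : ℝ) := by push_cast; linarith
  have : 1 = 2 * j := by exact_mod_cast this
  omega

variable {Ω : Type*} [MeasurableSpace Ω]

theorem hasSum_integral_pow_smul {G : Type*} [NormedAddCommGroup G] [NormedSpace ℝ G]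
    [CompleteSpace G] (m : Measure Ω) [IsFiniteMeasure m] {X : Ω → ℝ} (hX : Measurable X) {C : ℝ}
    (hC : ∀ ω, |X ω| ≤ C) (a : ℕ → G) (ha : Summable fun k => ‖a k‖ * C ^ k) :
    HasSum (fun k => (∫ ω, X ω ^ k ∂m) • a k) (∫ ω, ∑' k, X ω ^ k • a k ∂m) := by
  have hint : ∀ k, Integrable (fun ω => X ω ^ k) m := fun k =>
    Integrable.of_bound (hX.pow_const k).aestronglyMeasurable (C ^ k)
      (ae_of_all _ fun ω => by
        rw [Real.norm_eq_abs, abs_pow]; exact pow_le_pow_left₀ (abs_nonneg _) (hC ω) k)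
  simp_rw [← integral_smul_const]
  refine hasSum_integral_of_summable_integral_norm (fun k => (hint k).smul_const _) ?_
  refine Summable.of_nonneg_of_le (fun k => by positivity) (fun k => ?_) (ha.mul_left (m.real univ))
  calc ∫ ω, ‖X ω ^ k • a k‖ ∂m ≤ ∫ ω, ‖a k‖ * C ^ k ∂m := by
        refine integral_mono ((hint k).smul_const _).norm (integrable_const _) fun ω => ?_
        simp only [norm_smul, norm_pow, Real.norm_eq_abs]
        rw [mul_comm]
        gcongr
        exact hC ω
    _ = _ := by simp

theorem hasSum_sqrt_one_add {x : ℝ} (hx : |x| < 1) :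
    HasSum (fun k => x ^ k * Ring.choose (1 / 2 : ℝ) k) (√(1 + x)) := by
  have hmem : x ∈ Metric.eball (0 : ℝ) 1 := by
    rwa [Metric.mem_eball, edist_dist, ENNReal.ofReal_lt_one, dist_zero_right]
  have := (Real.one_add_rpow_hasFPowerSeriesOnBall_zero (a := 1 / 2)).hasSum hmem
  rw [zero_add, ← Real.sqrt_eq_rpow] at this
  simpa [binomialSeries, FormalMultilinearSeries.coeff_ofScalars] using this

theorem summable_choose_half {x : ℝ} (hx0 : 0 ≤ x) (hx : x < 1) :
    Summable fun k => ‖Ring.choose (1 / 2 : ℝ) k‖ * x ^ k := by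
  lift x to ℝ≥0 using hx0
  have := (binomialSeries ℝ (1 / 2 : ℝ)).summable_norm_mul_pow (r := x)
    (lt_of_lt_of_le (by exact_mod_cast hx) binomialSeries_radius_ge_one)
  simpa only [binomialSeries, FormalMultilinearSeries.ofScalars_norm] using this

theorem hasSum_integral_sqrt_one_add (m : Measure Ω) [IsFiniteMeasure m] {X : Ω → ℝ}
    (hX : Measurable X) {C : ℝ} (hC : ∀ ω, |X ω| ≤ C) (hC0 : 0 ≤ C) {s : ℝ} (hs : |s| * C < 1) :
    HasSum (fun k => s ^ k * ((∫ ω, X ω ^ k ∂m) * Ring.choose (1 / 2 : ℝ) k))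
      (∫ ω, √(1 + s * X ω) ∂m) := by
  have hb : ∀ ω, |s * X ω| ≤ |s| * C := fun ω => by
    rw [abs_mul]; exact mul_le_mul_of_nonneg_left (hC ω) (abs_nonneg _)
  have := hasSum_integral_pow_smul m (hX.const_mul s) hb _
    (summable_choose_half (by positivity) hs)
  simp_rw [smul_eq_mul, (hasSum_sqrt_one_add ((hb _).trans_lt hs)).tsum_eq, mul_pow,
    integral_const_mul, mul_assoc] at this
  exact this

theorem integral_pow_eq_of_integral_sqrt_eq (m₁ m₂ : Measure Ω) [IsFiniteMeasure m₁]
    [IsFiniteMeasure m₂] {X : Ω → ℝ} (hX : Measurable X) {C : ℝ} (hC : ∀ ω, |X ω| ≤ C)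
    (hC0 : 0 < C) (h : ∀ s : ℝ, |s| * C < 1 → ∫ ω, √(1 + s * X ω) ∂m₁ = ∫ ω, √(1 + s * X ω) ∂m₂)
    (k : ℕ) : ∫ ω, X ω ^ k ∂m₁ = ∫ ω, X ω ^ k ∂m₂ := by
  have key : ∀ (m : Measure Ω) [IsFiniteMeasure m],
      HasFPowerSeriesAt (fun s => ∫ ω, √(1 + s * X ω) ∂m)
        (FormalMultilinearSeries.ofScalars ℝ
          fun k => (∫ ω, X ω ^ k ∂m) * Ring.choose (1 / 2 : ℝ) k) 0 := by
    intro m _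
    rw [hasFPowerSeriesAt_iff]
    have : ∀ᶠ s : ℝ in nhds 0, |s| * C < 1 := by
      have hc : Continuous fun s : ℝ => |s| * C := by fun_prop
      exact hc.continuousAt.eventually_lt continuousAt_const (by simp)
    filter_upwards [this] with s hs
    simpa [FormalMultilinearSeries.coeff_ofScalars] using
      hasSum_integral_sqrt_one_add m hX hC hC0.le hs
  have h2 := (key m₁).eq_formalMultilinearSeries_of_eventually (key m₂) (by
    have : ∀ᶠ s : ℝ in nhds 0, |s| * C < 1 := by
      have hc : Continuous fun s : ℝ => |s| * C := by fun_prop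
      exact hc.continuousAt.eventually_lt continuousAt_const (by simp)
    filter_upwards [this] with s hs using h s hs)
  have h3 := congrArg (fun p => FormalMultilinearSeries.coeff p k) h2
  simp only [FormalMultilinearSeries.coeff_ofScalars] at h3
  exact mul_right_cancel₀ (choose_half_ne_zero k) h3

theorem integral_cexp_eq_of_integral_pow_eq (m₁ m₂ : Measure Ω) [IsFiniteMeasure m₁]
    [IsFiniteMeasure m₂] {X : Ω → ℝ} (hX : Measurable X) {C : ℝ} (hC : ∀ ω, |X ω| ≤ C)
    (h : ∀ k : ℕ, ∫ ω, X ω ^ k ∂m₁ = ∫ ω, X ω ^ k ∂m₂) :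
    ∫ ω, Complex.exp (X ω * Complex.I) ∂m₁ = ∫ ω, Complex.exp (X ω * Complex.I) ∂m₂ := by
  have hexp : ∀ x : ℝ, ∑' k : ℕ, x ^ k • (Complex.I ^ k / (k.factorial : ℂ)) =
      Complex.exp (x * Complex.I) := by
    intro x
    rw [Complex.exp_eq_exp_ℂ, NormedSpace.exp_eq_tsum_div]
    refine tsum_congr fun k => ?_
    rw [Complex.real_smul, mul_pow]; push_cast; ring
  have key : ∀ (m : Measure Ω) [IsFiniteMeasure m],
      HasSum (fun k : ℕ => (∫ ω, X ω ^ k ∂m) • (Complex.I ^ k / (k.factorial : ℂ)))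
        (∫ ω, Complex.exp (X ω * Complex.I) ∂m) := by
    intro m _
    have := hasSum_integral_pow_smul m hX hC
      (fun k : ℕ => Complex.I ^ k / (k.factorial : ℂ)) (by
        refine (Real.summable_pow_div_factorial C).congr fun k => ?_
        simp [div_eq_inv_mul])
    simpa only [hexp] using this
  have h1 := key m₁
  simp_rw [h] at h1
  exact h1.unique (key m₂)

end Moments

/-- The support function of the symmetrization of `L`. -/
def supAbs {E : Type*} [NormedAddCommGroup E] [InnerProductSpace ℝ E] (L : Set E) (v : E) : ℝ :=
  ⨆ x : L, |⟪x.1, v⟫|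

section Injectivity

variable {ι : Type*} [Fintype ι]

def tensorSq (v : EuclideanSpace ℝ ι) : EuclideanSpace ℝ (ι × ι) :=
  WithLp.toLp 2 fun p => v p.1 * v p.2

theorem inner_tensorSq (v : EuclideanSpace ℝ ι) (w : EuclideanSpace ℝ (ι × ι)) :
    ⟪tensorSq v, w⟫ = ∑ i, ∑ j, v i * v j * w (i, j) := by
  simp [tensorSq, PiLp.inner_apply, Fintype.sum_prod_type, mul_comm]

theorem inner_tensorSq_tensorSq (x v : EuclideanSpace ℝ ι) :
    ⟪tensorSq x, tensorSq v⟫ = ⟪x, v⟫ ^ 2 := by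
  rw [inner_tensorSq, sq, PiLp.inner_apply, Finset.sum_mul_sum]
  refine Finset.sum_congr rfl fun i _ => Finset.sum_congr rfl fun j _ => ?_
  simp [tensorSq]; ring

theorem norm_tensorSq (v : EuclideanSpace ℝ ι) : ‖tensorSq v‖ = ‖v‖ ^ 2 := by
  have := inner_tensorSq_tensorSq v v
  rw [real_inner_self_eq_norm_sq, real_inner_self_eq_norm_sq] at this
  exact (pow_left_inj₀ (norm_nonneg _) (by positivity) two_ne_zero).mp this

omit [Fintype ι] in
theorem continuous_tensorSq : Continuous (tensorSq : EuclideanSpace ℝ ι → _) := by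
  unfold tensorSq
  fun_prop

def dirTensor (v : EuclideanSpace ℝ ι) : EuclideanSpace ℝ (ι × ι) :=
  (‖v‖ ^ 2)⁻¹ • tensorSq v

theorem measurable_dirTensor : Measurable (dirTensor : EuclideanSpace ℝ ι → _) :=
  (by fun_prop : Measurable fun v : EuclideanSpace ℝ ι => (‖v‖ ^ 2)⁻¹).smul
    continuous_tensorSq.measurable

theorem norm_dirTensor_le (v : EuclideanSpace ℝ ι) : ‖dirTensor v‖ ≤ 1 := by
  rw [dirTensor, norm_smul, norm_tensorSq, norm_inv, norm_pow, norm_norm]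
  exact inv_mul_le_one

theorem abs_inner_dirTensor_le (v : EuclideanSpace ℝ ι) (w : EuclideanSpace ℝ (ι × ι)) :
    |⟪dirTensor v, w⟫| ≤ ‖w‖ :=
  (abs_real_inner_le_norm _ _).trans
    (mul_le_of_le_one_left (norm_nonneg _) (norm_dirTensor_le v))

theorem norm_sq_mul_inner_dirTensor (v : EuclideanSpace ℝ ι) (w : EuclideanSpace ℝ (ι × ι)) :
    ‖v‖ ^ 2 * ⟪dirTensor v, w⟫ = ⟪tensorSq v, w⟫ := by
  rcases eq_or_ne v 0 with rfl | hv
  · simp [inner_tensorSq]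
  · have : ‖v‖ ≠ 0 := norm_ne_zero_iff.mpr hv
    rw [dirTensor, inner_smul_left]
    simp; field_simp

theorem norm_mul_sqrt_inner_dirTensor (x v : EuclideanSpace ℝ ι) :
    ‖v‖ * √⟪tensorSq x, dirTensor v⟫ = |⟪x, v⟫| := by
  rw [← Real.sqrt_sq (norm_nonneg v), ← Real.sqrt_mul (by positivity),
    real_inner_comm, norm_sq_mul_inner_dirTensor, inner_tensorSq_tensorSq, Real.sqrt_sq_eq_abs,
    real_inner_comm]

open Matrix in
theorem exists_norm_map_eq_sqrt [DecidableEq ι] (w : EuclideanSpace ℝ (ι × ι)) {s : ℝ}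
    (hs : |s| * ‖w‖ ≤ 1) :
    ∃ (m : ℕ) (A : EuclideanSpace ℝ ι →L[ℝ] EuclideanSpace ℝ (Fin m)),
      ∀ v, ‖A v‖ = ‖v‖ * √(1 + s * ⟪dirTensor v, w⟫) := by
  set W : Matrix ι ι ℝ := Matrix.of fun i j => w (i, j)
  set M : Matrix ι ι ℝ := 1 + (s / 2) • (W + Wᵀ) with hM
  have hW : ∀ v : ι → ℝ, v ⬝ᵥ (W *ᵥ v) = ⟪tensorSq (WithLp.toLp 2 v), w⟫ := by
    intro v
    simp only [inner_tensorSq, dotProduct, mulVec, Finset.mul_sum, W, Matrix.of_apply]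
    exact Finset.sum_congr rfl fun i _ => Finset.sum_congr rfl fun j _ => by ring
  have hWt : ∀ v : ι → ℝ, v ⬝ᵥ (Wᵀ *ᵥ v) = v ⬝ᵥ (W *ᵥ v) := by
    intro v
    rw [mulVec_transpose, dotProduct_comm, dotProduct_mulVec]
  have hquad : ∀ v : ι → ℝ, v ⬝ᵥ (M *ᵥ v) =
      ‖WithLp.toLp 2 v‖ ^ 2 * (1 + s * ⟪dirTensor (WithLp.toLp 2 v), w⟫) := by
    intro v
    rw [mul_add, mul_one, mul_left_comm, norm_sq_mul_inner_dirTensor, hM, add_mulVec,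
      smul_mulVec, add_mulVec, one_mulVec, dotProduct_add, dotProduct_smul, dotProduct_add, hWt,
      hW, EuclideanSpace.real_norm_sq_eq]
    simp only [dotProduct, smul_eq_mul, sq]
    ring
  have hpos : ∀ v : EuclideanSpace ℝ ι, 0 ≤ 1 + s * ⟪dirTensor v, w⟫ := by
    intro v
    have h1 : |s * ⟪dirTensor v, w⟫| ≤ 1 := by
      rw [abs_mul]
      exact (mul_le_mul_of_nonneg_left (abs_inner_dirTensor_le v w) (abs_nonneg s)).trans hs
    linarith [neg_le_of_abs_le h1]
  have hPSD : M.PosSemidef := by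
    refine PosSemidef.of_dotProduct_mulVec_nonneg ?_ fun v => ?_
    · simp [hM, IsHermitian, conjTranspose_eq_transpose_of_trivial, add_comm]
    · rw [star_trivial, hquad]
      exact mul_nonneg (by positivity) (hpos _)
  obtain ⟨m, a, ha⟩ := posSemidef_iff_eq_sum_vecMulVec.mp hPSD
  refine ⟨m, (Matrix.toEuclideanLin (Matrix.of a)).toContinuousLinearMap, fun v => ?_⟩
  rw [← Real.sqrt_sq (norm_nonneg v), ← Real.sqrt_mul (by positivity),
    ← Real.sqrt_sq (norm_nonneg _)]
  congr 1
  rw [show v = WithLp.toLp 2 v.ofLp from rfl, ← hquad, ha, EuclideanSpace.real_norm_sq_eq,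
    sum_mulVec, dotProduct_sum]
  refine Finset.sum_congr rfl fun k _ => ?_
  simp [vecMulVec_mulVec, dotProduct_smul, toLpLin_apply, mulVec, sq, dotProduct_comm]

theorem map_dirTensor_eq {μ₁ μ₂ : Measure (EuclideanSpace ℝ ι)} [IsFiniteMeasure μ₁]
    [IsFiniteMeasure μ₂]
    (h₁ : Integrable (fun v => ‖v‖) μ₁) (h₂ : Integrable (fun v => ‖v‖) μ₂)
    (h : ∀ u, ∫ v, |⟪u, v⟫| ∂μ₁ = ∫ v, |⟪u, v⟫| ∂μ₂) :
    (μ₁.withDensity fun v => (‖v‖₊ : ℝ≥0∞)).map dirTensor =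
      (μ₂.withDensity fun v => (‖v‖₊ : ℝ≥0∞)).map dirTensor := by
  classical
  have hfin : ∀ {μ : Measure (EuclideanSpace ℝ ι)}, Integrable (fun v => ‖v‖) μ →
      IsFiniteMeasure (μ.withDensity fun v => (‖v‖₊ : ℝ≥0∞)) := by
    intro μ hμ
    refine isFiniteMeasure_withDensity ?_
    have := hμ.2
    rw [HasFiniteIntegral] at this
    simpa [enorm_eq_nnnorm] using this.ne
  have hfin₁ := hfin h₁
  have hfin₂ := hfin h₂
  refine Measure.ext_of_charFun ?_
  ext w
  have hmeas : Measurable fun v : EuclideanSpace ℝ ι => ⟪dirTensor v, w⟫ :=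
    measurable_dirTensor.inner_const
  have hC : ∀ v : EuclideanSpace ℝ ι, |⟪dirTensor v, w⟫| ≤ ‖w‖ + 1 := fun v =>
    (abs_inner_dirTensor_le v w).trans (by linarith)
  simp_rw [charFun_apply]
  rw [integral_map measurable_dirTensor.aemeasurable (by fun_prop),
    integral_map measurable_dirTensor.aemeasurable (by fun_prop)]
  refine integral_cexp_eq_of_integral_pow_eq _ _ hmeas hC ?_
  refine integral_pow_eq_of_integral_sqrt_eq _ _ hmeas hC (by positivity) fun s hs => ?_
  obtain ⟨m, A, hA⟩ := exists_norm_map_eq_sqrt w (s := s)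
    (by nlinarith [abs_nonneg s])
  have := integral_norm_map_eq h₁ h₂ h A
  simp_rw [hA] at this
  rw [integral_withDensity_eq_integral_smul measurable_nnnorm,
    integral_withDensity_eq_integral_smul measurable_nnnorm]
  exact this

theorem integral_supAbs_eq {μ₁ μ₂ : Measure (EuclideanSpace ℝ ι)} [IsFiniteMeasure μ₁]
    [IsFiniteMeasure μ₂]
    (h₁ : Integrable (fun v => ‖v‖) μ₁) (h₂ : Integrable (fun v => ‖v‖) μ₂)
    (h : ∀ u, ∫ v, |⟪u, v⟫| ∂μ₁ = ∫ v, |⟪u, v⟫| ∂μ₂)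
    {L : Set (EuclideanSpace ℝ ι)} (hL : Bornology.IsBounded L) :
    ∫ v, supAbs L v ∂μ₁ = ∫ v, supAbs L v ∂μ₂ := by
  set H : EuclideanSpace ℝ (ι × ι) → ℝ := fun M => ⨆ x : L, √⟪tensorSq x.1, M⟫ with hH
  have hHm : Measurable H := by
    obtain ⟨R, hR⟩ := hL.exists_norm_le
    refine (lowerSemicontinuous_ciSup (fun M => ⟨√(R ^ 2 * ‖M‖), ?_⟩) fun x => ?_).measurable
    · rintro _ ⟨x, rfl⟩
      refine Real.sqrt_le_sqrt ((real_inner_le_norm _ _).trans ?_)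
      rw [norm_tensorSq]
      gcongr
      exact hR x x.2
    · exact Continuous.lowerSemicontinuous (by fun_prop)
  have key : ∀ μ : Measure (EuclideanSpace ℝ ι), ∫ v, supAbs L v ∂μ =
      ∫ M, H M ∂((μ.withDensity fun v => (‖v‖₊ : ℝ≥0∞)).map dirTensor) := by
    intro μ
    rw [integral_map measurable_dirTensor.aemeasurable hHm.aestronglyMeasurable,
      integral_withDensity_eq_integral_smul measurable_nnnorm]
    refine integral_congr_ae (ae_of_all _ fun v => ?_)
    change _ = ‖v‖ * H (dirTensor v)
    simp only [hH, supAbs]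
    rw [Real.mul_iSup_of_nonneg (norm_nonneg v)]
    simp_rw [norm_mul_sqrt_inner_dirTensor]
  rw [key, key, map_dirTensor_eq h₁ h₂ h]

end Injectivity

section Fibers

variable {E : Type*} [NormedAddCommGroup E] [InnerProductSpace ℝ E]

/-- The part of `A` on the line through `y` in direction `u`. -/
def fiber (A : Set E) (u : E) (y : (ℝ ∙ u)ᗮ) : Set ℝ := {s | (y : E) + s • u ∈ A}

/-- The orthogonal projection of `A` along `u`. -/
def shadow (A : Set E) (u : E) : Set (ℝ ∙ u)ᗮ := {y | (fiber A u y).Nonempty}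

theorem mem_fiber {A : Set E} {u : E} {y : (ℝ ∙ u)ᗮ} {s : ℝ} :
    s ∈ fiber A u y ↔ (y : E) + s • u ∈ A := Iff.rfl

theorem Convex.fiber {A : Set E} (hA : Convex ℝ A) (u : E) (y : (ℝ ∙ u)ᗮ) :
    Convex ℝ (fiber A u y) := by
  intro s hs t ht a b ha hb hab
  have := hA hs ht ha hb hab
  rw [mem_fiber]
  convert this using 1
  simp only [smul_add, smul_smul, smul_eq_mul, add_smul]
  nth_rewrite 1 [← one_smul ℝ (y : E)]
  rw [← hab, add_smul]
  abel

theorem norm_sq_add_smul {u : E} (hu : ‖u‖ = 1) (y : (ℝ ∙ u)ᗮ) (s : ℝ) :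
    ‖(y : E) + s • u‖ ^ 2 = ‖y‖ ^ 2 + s ^ 2 := by
  have h : ⟪(y : E), s • u⟫ = 0 := by
    rw [inner_smul_right, Submodule.mem_orthogonal_singleton_iff_inner_left.mp y.2, mul_zero]
  rw [norm_add_sq_real, h, norm_smul, hu]
  simp

theorem IsCompact.fiber {A : Set E} (hA : IsCompact A) {u : E} (hu : ‖u‖ = 1) (y : (ℝ ∙ u)ᗮ) :
    IsCompact (fiber A u y) := by
  obtain ⟨R, hR⟩ := hA.isBounded.exists_norm_le
  refine isCompact_of_isClosed_isBounded
    (hA.isClosed.preimage (f := fun s : ℝ => (y : E) + s • u) (by fun_prop)) ?_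
  refine (isBounded_iff_forall_norm_le).mpr ⟨R, fun s hs => ?_⟩
  have h1 := hR _ hs
  have h2 := norm_sq_add_smul hu y s
  have h0 : 0 ≤ R := (norm_nonneg _).trans h1
  refine abs_le_of_sq_le_sq ?_ h0
  nlinarith [norm_nonneg ((y : E) + s • u), sq_nonneg ‖y‖]

theorem shadow_eq_image [FiniteDimensional ℝ E] (A : Set E) {u : E} (hu : ‖u‖ = 1) :
    shadow A u = (ℝ ∙ u)ᗮ.orthogonalProjectionOnto '' A := by
  ext y
  constructor
  · rintro ⟨s, hs⟩
    refine ⟨_, hs, ?_⟩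
    rw [map_add, Submodule.orthogonalProjectionOnto_mem_subspace_eq_self, map_smul,
      (Submodule.orthogonalProjectionOnto_eq_zero_iff).mpr
        (Submodule.le_orthogonal_orthogonal _ (Submodule.mem_span_singleton_self u)),
      smul_zero, add_zero]
  · rintro ⟨x, hx, rfl⟩
    refine ⟨⟪u, x⟫, ?_⟩
    have h := Submodule.starProjection_add_starProjection_orthogonal (K := ℝ ∙ u) x
    rw [Submodule.starProjection_unit_singleton ℝ hu, add_comm] at h
    rw [mem_fiber]
    rwa [← h] at hx

theorem IsCompact.shadow [FiniteDimensional ℝ E] {A : Set E} (hA : IsCompact A) {u : E}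
    (hu : ‖u‖ = 1) : IsCompact (shadow A u) := by
  rw [shadow_eq_image A hu]
  exact hA.image (ContinuousLinearMap.continuous _)

theorem volume_Icc_thickening {T : Set ℝ} (hT : IsCompact T) (hTc : Convex ℝ T)
    (hne : T.Nonempty) {ε : ℝ} (hε : 0 ≤ ε) :
    volume {s : ℝ | ∃ σ ∈ Icc (-1 : ℝ) 1, s - ε * σ ∈ T} = volume T + ENNReal.ofReal (2 * ε) := by
  have hTI := eq_Icc_of_connected_compact ⟨hne, hTc.isPreconnected⟩ hT
  set a := sInf T
  set b := sSup T
  have hab : a ≤ b := by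
    rw [hTI] at hne; exact nonempty_Icc.mp hne
  have : {s : ℝ | ∃ σ ∈ Icc (-1 : ℝ) 1, s - ε * σ ∈ T} = Icc (a - ε) (b + ε) := by
    rw [hTI]
    ext s
    constructor
    · rintro ⟨σ, ⟨h1, h2⟩, h3, h4⟩
      constructor <;> nlinarith
    · rintro ⟨h1, h2⟩
      rcases lt_or_ge s a with h | h
      · rcases hε.eq_or_lt with rfl | hε'
        · linarith
        refine ⟨(s - a) / ε, ⟨by rw [le_div_iff₀ hε']; linarith,
          by rw [div_le_iff₀ hε']; linarith⟩, ?_⟩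
        rw [mul_div_cancel₀ _ hε'.ne']
        constructor <;> linarith
      rcases lt_or_ge b s with h' | h'
      · rcases hε.eq_or_lt with rfl | hε'
        · linarith
        refine ⟨(s - b) / ε, ⟨by rw [le_div_iff₀ hε']; linarith,
          by rw [div_le_iff₀ hε']; linarith⟩, ?_⟩
        rw [mul_div_cancel₀ _ hε'.ne']
        constructor <;> linarith
      · exact ⟨0, by norm_num, by constructor <;> linarith⟩
  rw [this, hTI, Real.volume_Icc, Real.volume_Icc, ← ENNReal.ofReal_add (by linarith) (by linarith)]
  congr 1; ring

variable [FiniteDimensional ℝ E] [MeasurableSpace E] [BorelSpace E]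

theorem volume_eq_lintegral_fiber {u : E} (hu : ‖u‖ = 1) {A : Set E} (hA : MeasurableSet A) :
    volume A = ∫⁻ y : (ℝ ∙ u)ᗮ, volume (fiber A u y) := by
  have h1 := ((ℝ ∙ u).measurePreserving_measurableEquivProd (0 : E)).symm
  rw [InnerProductSpace.euclideanHausdorffMeasure_eq_volume] at h1
  have h2 : MeasurePreserving
      (Prod.map (LinearIsometryEquiv.toSpanUnitSingleton (𝕜 := ℝ) u hu) (id : (ℝ ∙ u)ᗮ → (ℝ ∙ u)ᗮ))
      (volume.prod volume) (volume.prod volume) :=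
    (LinearIsometryEquiv.measurePreserving _).prod (MeasurePreserving.id volume)
  have h3 := h1.comp h2
  rw [← h3.measure_preimage hA.nullMeasurableSet,
    Measure.prod_apply_symm (h3.measurable hA)]
  refine lintegral_congr fun y => ?_
  congr 1
  ext s
  simp [mem_fiber, add_comm]

omit [FiniteDimensional ℝ E] [MeasurableSpace E] [BorelSpace E] in
theorem isCompact_segment_thickening {S : Set E} (hS : IsCompact S) (u : E) (ε : ℝ) :
    IsCompact {x : E | ∃ σ ∈ Icc (-1 : ℝ) 1, x - (ε * σ) • u ∈ S} := by
  have := ((isCompact_Icc (a := (-1 : ℝ)) (b := 1)).prod hS).image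
    (f := fun p : ℝ × E => p.2 + (ε * p.1) • u) (by fun_prop)
  convert this using 1
  ext x
  constructor
  · rintro ⟨σ, hσ, hx⟩
    exact ⟨(σ, _), ⟨hσ, hx⟩, by simp⟩
  · rintro ⟨⟨σ, z⟩, ⟨hσ, hz⟩, rfl⟩
    exact ⟨σ, hσ, by simpa using hz⟩

theorem volume_segment_thickening {S : Set E} (hS : IsCompact S) (hSc : Convex ℝ S) {u : E}
    (hu : ‖u‖ = 1) {ε : ℝ} (hε : 0 ≤ ε) :
    volume {x : E | ∃ σ ∈ Icc (-1 : ℝ) 1, x - (ε * σ) • u ∈ S} =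
      volume S + ENNReal.ofReal (2 * ε) * volume (shadow S u) := by
  have hm : MeasurableSet (shadow S u) := (hS.shadow hu).isClosed.measurableSet
  rw [volume_eq_lintegral_fiber hu (isCompact_segment_thickening hS u ε).isClosed.measurableSet,
    volume_eq_lintegral_fiber hu hS.isClosed.measurableSet, ← setLIntegral_const,
    ← lintegral_indicator hm, ← lintegral_add_right _ (measurable_const.indicator hm)]
  refine lintegral_congr fun y => ?_
  have hfib : fiber {x : E | ∃ σ ∈ Icc (-1 : ℝ) 1, x - (ε * σ) • u ∈ S} u y =
      {s : ℝ | ∃ σ ∈ Icc (-1 : ℝ) 1, s - ε * σ ∈ fiber S u y} := by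
    ext s
    simp only [mem_fiber, mem_ofPred_eq, sub_smul, add_sub_assoc]
  rw [hfib]
  by_cases hy : (fiber S u y).Nonempty
  · rw [indicator_of_mem (show y ∈ shadow S u from hy),
      volume_Icc_thickening (hS.fiber hu y) (hSc.fiber u y) hy hε]
  · rw [indicator_of_notMem (show y ∉ shadow S u from hy)]
    rw [not_nonempty_iff_eq_empty] at hy
    simp [hy]

omit [FiniteDimensional ℝ E] [MeasurableSpace E] [BorelSpace E] in
open Pointwise in
theorem shadow_smul (S : Set E) (u : E) {t : ℝ} (ht : t ≠ 0) :
    shadow (t • S) u = t • shadow S u := by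
  ext y
  rw [mem_smul_set_iff_inv_smul_mem₀ ht]
  constructor
  · rintro ⟨s, hs⟩
    refine ⟨t⁻¹ * s, ?_⟩
    rw [mem_fiber, mem_smul_set_iff_inv_smul_mem₀ ht] at hs
    simpa [mem_fiber, smul_smul] using hs
  · rintro ⟨s, hs⟩
    refine ⟨t * s, ?_⟩
    rw [mem_fiber, mem_smul_set_iff_inv_smul_mem₀ ht]
    simpa [mem_fiber, smul_smul, ht] using hs

end Fibers

section SymmetricBody

open Filter Topology Pointwise

/-- An origin-symmetric convex body, with the origin as interior point. -/
structure IsSymmBody {E : Type*} [NormedAddCommGroup E] [InnerProductSpace ℝ E] (K : Set E) :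
    Prop where
  convex : Convex ℝ K
  isCompact : IsCompact K
  neg_mem : ∀ x ∈ K, -x ∈ K
  mem_nhds : K ∈ 𝓝 (0 : E)

variable {E : Type*} [NormedAddCommGroup E] [InnerProductSpace ℝ E] {K L : Set E}

theorem IsSymmBody.gauge_le_iff (hK : IsSymmBody K) {t : ℝ} (ht : 0 < t) (x : E) :
    gauge K x ≤ t ↔ x ∈ t • K := by
  have h := gauge_le_one_iff_mem_closure hK.convex hK.mem_nhds (x := t⁻¹ • x)
  rw [hK.isCompact.isClosed.closure_eq, gauge_smul_of_nonneg (inv_nonneg.mpr ht.le), smul_eq_mul,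
    inv_mul_le_iff₀ ht, mul_one] at h
  rw [h, mem_smul_set_iff_inv_smul_mem₀ ht.ne']

theorem IsSymmBody.gauge_le_one_iff (hK : IsSymmBody K) (x : E) : gauge K x ≤ 1 ↔ x ∈ K := by
  rw [hK.gauge_le_iff one_pos, one_smul]

theorem IsSymmBody.continuous_gauge (hK : IsSymmBody K) : Continuous (gauge K) :=
  _root_.continuous_gauge hK.convex hK.mem_nhds

theorem IsSymmBody.gauge_add_le (hK : IsSymmBody K) (x y : E) :
    gauge K (x + y) ≤ gauge K x + gauge K y :=
  _root_.gauge_add_le hK.convex (absorbent_nhds_zero hK.mem_nhds) x y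

theorem IsSymmBody.gauge_neg (hK : IsSymmBody K) (x : E) : gauge K (-x) = gauge K x :=
  _root_.gauge_neg hK.neg_mem x

theorem IsSymmBody.abs_gauge_sub_le (hK : IsSymmBody K) (x y : E) :
    |gauge K (x - y) - gauge K x| ≤ gauge K y := by
  have h1 := hK.gauge_add_le x (-y)
  have h2 := hK.gauge_add_le (x - y) y
  rw [hK.gauge_neg, ← sub_eq_add_neg] at h1
  rw [sub_add_cancel] at h2
  rw [abs_le]; constructor <;> linarith

/-- The infimal convolution of the gauge of `K` with the indicator of `ε • L`; its sublevel sets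
are `t • K + ε • L`. -/
def infGauge (K L : Set E) (ε : ℝ) (x : E) : ℝ := sInf ((fun w => gauge K (x - ε • w)) '' L)

theorem bddBelow_gauge_image (K L : Set E) (ε : ℝ) (x : E) :
    BddBelow ((fun w => gauge K (x - ε • w)) '' L) :=
  ⟨0, by rintro _ ⟨w, -, rfl⟩; exact gauge_nonneg _⟩

theorem infGauge_le (K : Set E) {L : Set E} (ε : ℝ) (x : E) {w : E} (hw : w ∈ L) :
    infGauge K L ε x ≤ gauge K (x - ε • w) :=
  csInf_le (bddBelow_gauge_image K L ε x) ⟨w, hw, rfl⟩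

theorem infGauge_nonneg (K L : Set E) (ε : ℝ) (x : E) : 0 ≤ infGauge K L ε x :=
  Real.sInf_nonneg (by rintro _ ⟨w, -, rfl⟩; exact gauge_nonneg _)

theorem IsSymmBody.exists_infGauge_eq (hK : IsSymmBody K) (hL : IsCompact L) (hne : L.Nonempty)
    (ε : ℝ) (x : E) : ∃ w ∈ L, infGauge K L ε x = gauge K (x - ε • w) := by
  have hc : Continuous fun w => gauge K (x - ε • w) := hK.continuous_gauge.comp (by fun_prop)
  obtain ⟨w, hw, h⟩ := (hL.image hc).sInf_mem (hne.image _)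
  exact ⟨w, hw, h.symm⟩

theorem IsSymmBody.infGauge_le_iff (hK : IsSymmBody K) (hL : IsCompact L) (hne : L.Nonempty)
    {ε t : ℝ} (x : E) : infGauge K L ε x ≤ t ↔ ∃ w ∈ L, gauge K (x - ε • w) ≤ t := by
  constructor
  · intro h
    obtain ⟨w, hw, hx⟩ := hK.exists_infGauge_eq hL hne ε x
    exact ⟨w, hw, hx ▸ h⟩
  · rintro ⟨w, hw, h⟩
    exact (infGauge_le K ε x hw).trans h

theorem IsSymmBody.continuous_infGauge (hK : IsSymmBody K) (hL : IsCompact L) (ε : ℝ) :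
    Continuous (infGauge K L ε) :=
  hL.continuous_sInf (f := fun x w => gauge K (x - ε • w))
    (hK.continuous_gauge.comp (by fun_prop))

theorem IsSymmBody.abs_infGauge_sub_le (hK : IsSymmBody K) (hL : IsCompact L) (hne : L.Nonempty)
    {c : ℝ} (hc : ∀ w ∈ L, gauge K w ≤ c) {ε : ℝ} (hε : 0 ≤ ε) (x : E) :
    |infGauge K L ε x - gauge K x| ≤ ε * c := by
  obtain ⟨w, hw, h⟩ := hK.exists_infGauge_eq hL hne ε x
  rw [h]
  refine (hK.abs_gauge_sub_le x _).trans ?_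
  rw [gauge_smul_of_nonneg hε, smul_eq_mul]
  exact mul_le_mul_of_nonneg_left (hc w hw) hε

theorem supAbs_nonneg (L : Set E) (v : E) : 0 ≤ supAbs L v :=
  Real.iSup_nonneg fun _ => abs_nonneg _

theorem bddAbove_abs_inner (hL : Bornology.IsBounded L) (v : E) :
    BddAbove (range fun x : L => |⟪x.1, v⟫|) := by
  obtain ⟨R, hR⟩ := hL.exists_norm_le
  refine ⟨R * ‖v‖, ?_⟩
  rintro _ ⟨x, rfl⟩
  exact (abs_real_inner_le_norm _ _).trans
    (mul_le_mul_of_nonneg_right (hR x x.2) (norm_nonneg _))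

theorem abs_inner_le_supAbs (hL : Bornology.IsBounded L) (v : E) {x : E} (hx : x ∈ L) :
    |⟪x, v⟫| ≤ supAbs L v :=
  le_ciSup (bddAbove_abs_inner hL v) ⟨x, hx⟩

theorem supAbs_le {v : E} {b : ℝ} (hb : 0 ≤ b) (h : ∀ x ∈ L, |⟪x, v⟫| ≤ b) : supAbs L v ≤ b :=
  Real.iSup_le (fun x => h x x.2) hb

variable [FiniteDimensional ℝ E]

theorem IsSymmBody.tendsto_infGauge_slope (hK : IsSymmBody K) (hL : IsCompact L)
    (hne : L.Nonempty) (hLs : ∀ x ∈ L, -x ∈ L) {x : E} (hx : DifferentiableAt ℝ (gauge K) x) :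
    Tendsto (fun ε => (gauge K x - infGauge K L ε x) / ε) (𝓝[>] 0)
      (𝓝 (supAbs L (gradient (gauge K) x))) := by
  obtain ⟨R, hR⟩ := hL.isBounded.exists_norm_le
  have hR0 : 0 ≤ R := (norm_nonneg _).trans (hR _ hne.some_mem)
  set v := gradient (gauge K) x
  have hgrad : HasFDerivAt (gauge K) (innerSL ℝ v) x := hx.hasGradientAt.hasFDerivAt
  rw [Metric.tendsto_nhds]
  intro δ hδ
  set δ' := δ / (R + 1) / 2
  have hδ' : 0 < δ' := by positivity
  have hδR : δ' * R < δ := by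
    have : δ' * (R + 1) = δ / 2 := by simp only [δ']; field_simp
    nlinarith
  have hlo := (hasFDerivAt_iff_isLittleO_nhds_zero.mp hgrad).bound hδ'
  rw [Metric.eventually_nhds_iff] at hlo
  obtain ⟨ρ, hρ, hlo⟩ := hlo
  have hev : ∀ᶠ ε : ℝ in 𝓝[>] 0, ε * (R + 1) < ρ := by
    refine nhdsWithin_le_nhds ?_
    have hc : Continuous fun ε : ℝ => ε * (R + 1) := by fun_prop
    exact hc.continuousAt.eventually_lt continuousAt_const (by simpa using hρ)
  filter_upwards [hev, self_mem_nhdsWithin] with ε hε1 hε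
  have hε : 0 < ε := hε
  have hkey : ∀ w ∈ L, |gauge K (x - ε • w) - gauge K x + ε * ⟪w, v⟫| ≤ ε * (δ' * R) := by
    intro w hw
    have hn : ‖-(ε • w)‖ ≤ ε * R := by
      rw [norm_neg, norm_smul, Real.norm_of_nonneg hε.le]
      exact mul_le_mul_of_nonneg_left (hR w hw) hε.le
    have := hlo (y := -(ε • w)) (by rw [dist_zero_right]; nlinarith)
    rw [← sub_eq_add_neg, innerSL_apply_apply, inner_neg_right, inner_smul_right, sub_neg_eq_add,
      real_inner_comm, Real.norm_eq_abs] at this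
    nlinarith
  obtain ⟨w₀, hw₀, h₀⟩ := hK.exists_infGauge_eq hL hne ε x
  have hup : (gauge K x - infGauge K L ε x) / ε ≤ supAbs L v + δ' * R := by
    rw [div_le_iff₀ hε, h₀]
    have h1 := (abs_le.mp (hkey w₀ hw₀)).1
    have h2 := (le_abs_self _).trans (abs_inner_le_supAbs hL.isBounded v hw₀)
    nlinarith
  have hlow1 : ∀ w ∈ L, ⟪w, v⟫ ≤ (gauge K x - infGauge K L ε x) / ε + δ' * R := by
    intro w hw
    have h1 := (abs_le.mp (hkey w hw)).2
    have h2 := infGauge_le K ε x hw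
    have h3 : ⟪w, v⟫ - δ' * R ≤ (gauge K x - infGauge K L ε x) / ε := by
      rw [le_div_iff₀ hε]; nlinarith
    linarith
  have hlow2 : ∀ w ∈ L, |⟪w, v⟫| ≤ (gauge K x - infGauge K L ε x) / ε + δ' * R := by
    intro w hw
    have := hlow1 _ (hLs w hw)
    rw [inner_neg_left] at this
    exact abs_le.mpr ⟨by linarith, hlow1 w hw⟩
  have hlow := supAbs_le ((abs_nonneg _).trans (hlow2 _ hne.some_mem)) hlow2
  rw [Real.dist_eq, abs_lt]
  constructor <;> linarith

end SymmetricBody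

section SymmetricBody

open Filter Topology Pointwise

variable {E : Type*} [NormedAddCommGroup E] [InnerProductSpace ℝ E] {K L : Set E}
  [FiniteDimensional ℝ E] [MeasurableSpace E] [BorelSpace E]

omit [FiniteDimensional ℝ E] [MeasurableSpace E] [BorelSpace E] in
theorem IsSymmBody.exists_gauge_bound (hK : IsSymmBody K) (hL : IsCompact L) :
    ∃ c, 0 ≤ c ∧ ∀ w ∈ L, gauge K w ≤ c := by
  obtain ⟨c, hc⟩ := hL.bddAbove_image hK.continuous_gauge.continuousOn
  exact ⟨max c 0, le_max_right _ _, fun w hw => (hc ⟨w, hw, rfl⟩).trans (le_max_left _ _)⟩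

omit [FiniteDimensional ℝ E] in
theorem IsSymmBody.measurableSet (hK : IsSymmBody K) : MeasurableSet K :=
  hK.isCompact.isClosed.measurableSet

theorem IsSymmBody.ae_differentiableAt_gauge (hK : IsSymmBody K) :
    ∀ᵐ x : E, DifferentiableAt ℝ (gauge K) x := by
  obtain ⟨C, hC⟩ := hK.convex.lipschitz_gauge hK.mem_nhds
  exact hC.ae_differentiableAt

theorem IsSymmBody.ae_gauge_ne_one (hK : IsSymmBody K) : ∀ᵐ x : E, gauge K x ≠ 1 := by
  have h := hK.convex.addHaar_frontier (volume : Measure E)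
  refine measure_mono_null (fun x hx => ?_) h
  rw [mem_compl_iff, mem_ofPred_eq, not_not] at hx
  exact (gauge_eq_one_iff_mem_frontier hK.convex hK.mem_nhds).mp hx

theorem IsSymmBody.integrable_posPart_one_sub_infGauge (hK : IsSymmBody K) (hL : IsCompact L)
    (hne : L.Nonempty) {ε : ℝ} (hε : 0 ≤ ε) :
    Integrable fun x : E => max (1 - infGauge K L ε x) 0 := by
  obtain ⟨c, hc0, hc⟩ := hK.exists_gauge_bound hL
  refine Continuous.integrable_of_hasCompactSupport
    ((continuous_const.sub (hK.continuous_infGauge hL ε)).max continuous_const) ?_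
  refine HasCompactSupport.intro (hK.isCompact.smul (1 + ε * c)) fun x hx => ?_
  rw [← hK.gauge_le_iff (by positivity), not_le] at hx
  have := (abs_le.mp (hK.abs_infGauge_sub_le hL hne hc hε x)).1
  exact max_eq_right (by linarith)

theorem IsSymmBody.integrable_posPart_one_sub_gauge (hK : IsSymmBody K) :
    Integrable fun x : E => max (1 - gauge K x) 0 := by
  simpa [infGauge] using
    hK.integrable_posPart_one_sub_infGauge (isCompact_singleton (x := (0 : E))) ⟨0, rfl⟩ le_rfl

theorem IsSymmBody.tendsto_integral_slope (hK : IsSymmBody K) (hL : IsCompact L)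
    (hne : L.Nonempty) (hLs : ∀ x ∈ L, -x ∈ L) :
    Tendsto (fun ε => ((∫ x, max (1 - infGauge K L ε x) 0) - ∫ x, max (1 - gauge K x) 0) / ε)
      (𝓝[>] 0) (𝓝 (∫ x in K, supAbs L (gradient (gauge K) x))) := by
  obtain ⟨c, hc0, hc⟩ := hK.exists_gauge_bound hL
  have hpos : ∀ᶠ ε : ℝ in 𝓝[>] 0, 0 < ε := self_mem_nhdsWithin
  have hone : ∀ᶠ ε : ℝ in 𝓝[>] 0, ε < 1 := nhdsWithin_le_nhds (Iio_mem_nhds one_pos)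
  have hcont : ∀ x : E, Tendsto (fun ε => infGauge K L ε x) (𝓝[>] 0) (𝓝 (gauge K x)) := by
    intro x
    rw [tendsto_iff_dist_tendsto_zero]
    have h0 : Tendsto (fun ε : ℝ => ε * c) (𝓝[>] 0) (𝓝 0) := by
      have : Continuous fun ε : ℝ => ε * c := by fun_prop
      simpa using (this.tendsto 0).mono_left nhdsWithin_le_nhds
    refine squeeze_zero' (Eventually.of_forall fun _ => dist_nonneg) ?_ h0
    filter_upwards [hpos] with ε hε
    exact hK.abs_infGauge_sub_le hL hne hc hε.le x
  have key := tendsto_integral_filter_of_dominated_convergence (μ := (volume : Measure E))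
    (l := 𝓝[>] (0 : ℝ))
    (F := fun ε x => (max (1 - infGauge K L ε x) 0 - max (1 - gauge K x) 0) / ε)
    (f := K.indicator fun x => supAbs L (gradient (gauge K) x))
    (((1 + c) • K).indicator fun _ => c) ?_ ?_ ?_ ?_
  · rw [integral_indicator hK.measurableSet] at key
    refine key.congr' ?_
    filter_upwards [hpos] with ε hε
    rw [integral_div, integral_sub (hK.integrable_posPart_one_sub_infGauge hL hne hε.le)
      hK.integrable_posPart_one_sub_gauge]
  · refine Eventually.of_forall fun ε => Continuous.aestronglyMeasurable ?_
    exact (((continuous_const.sub (hK.continuous_infGauge hL ε)).max continuous_const).sub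
      ((continuous_const.sub hK.continuous_gauge).max continuous_const)).div_const _
  · filter_upwards [hpos, hone] with ε hε hε1
    refine ae_of_all _ fun x => ?_
    have hb := hK.abs_infGauge_sub_le hL hne hc hε.le x
    by_cases hx : x ∈ (1 + c) • K
    · rw [indicator_of_mem hx, norm_div, Real.norm_eq_abs, Real.norm_of_nonneg hε.le,
        div_le_iff₀ hε, mul_comm c]
      refine (abs_max_sub_max_le_abs _ _ _).trans ?_
      rwa [sub_sub_sub_cancel_left, abs_sub_comm]
    · rw [indicator_of_notMem hx]
      rw [← hK.gauge_le_iff (by positivity), not_le] at hx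
      have h1 := (abs_le.mp hb).1
      rw [max_eq_right (by nlinarith), max_eq_right (by linarith)]
      simp
  · refine (integrable_indicator_iff ?_).mpr ?_
    · exact (hK.isCompact.smul (1 + c)).isClosed.measurableSet
    · exact integrableOn_const (hK.isCompact.smul (1 + c)).measure_lt_top.ne
  · filter_upwards [hK.ae_differentiableAt_gauge, hK.ae_gauge_ne_one] with x hxd hx1
    rcases lt_or_gt_of_ne hx1 with hx | hx
    · rw [indicator_of_mem ((hK.gauge_le_one_iff x).mp hx.le)]
      refine (hK.tendsto_infGauge_slope hL hne hLs hxd).congr' ?_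
      filter_upwards [(hcont x).eventually (gt_mem_nhds hx)] with ε hε
      rw [max_eq_left (by linarith), max_eq_left (by linarith)]
      ring
    · rw [indicator_of_notMem fun h => hx.not_ge ((hK.gauge_le_one_iff x).mpr h)]
      refine tendsto_const_nhds.congr' ?_
      filter_upwards [(hcont x).eventually (lt_mem_nhds hx)] with ε hε
      rw [max_eq_right (by linarith), max_eq_right (by linarith)]
      simp

theorem ofReal_integral_posPart_one_sub {G : E → ℝ} (hG0 : ∀ x, 0 ≤ G x)
    (hint : Integrable fun x => max (1 - G x) 0) :
    ENNReal.ofReal (∫ x, max (1 - G x) 0) =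
      ∫⁻ t in Ioo (0 : ℝ) 1, volume {x | G x ≤ 1 - t} := by
  have hnn : 0 ≤ᵐ[volume] fun x => max (1 - G x) 0 := ae_of_all _ fun x => le_max_right _ _
  rw [ofReal_integral_eq_lintegral_ofReal hint hnn,
    lintegral_eq_lintegral_meas_le _ hnn hint.aestronglyMeasurable.aemeasurable,
    ← lintegral_indicator measurableSet_Ioi, ← lintegral_indicator measurableSet_Ioo]
  refine lintegral_congr_ae ?_
  have h1 : ∀ᵐ t : ℝ, t ≠ 1 := by
    simp [ae_iff]
  filter_upwards [h1] with t ht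
  by_cases ht0 : 0 < t
  · rw [indicator_of_mem (show t ∈ Ioi (0 : ℝ) from ht0)]
    have hset : {x | t ≤ max (1 - G x) 0} = {x | G x ≤ 1 - t} := by
      ext x
      simp only [mem_ofPred_eq, le_max_iff, ht0.not_ge, or_false]
      constructor <;> intro h <;> linarith
    rw [hset]
    by_cases ht1 : t < 1
    · rw [indicator_of_mem (show t ∈ Ioo (0 : ℝ) 1 from ⟨ht0, ht1⟩)]
    · rw [indicator_of_notMem fun h => ht1 h.2]
      have : {x | G x ≤ 1 - t} = ∅ := by
        refine eq_empty_of_forall_notMem fun x hx => ?_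
        have h2 := hG0 x
        have h3 : 1 < t := lt_of_le_of_ne (not_lt.mp ht1) ht.symm
        rw [mem_ofPred_eq] at hx
        linarith
      simp [this]
  · rw [indicator_of_notMem (show t ∉ Ioi (0 : ℝ) from ht0),
      indicator_of_notMem fun h => ht0 h.1]

theorem lintegral_Ioo_ofReal_pow (d : ℕ) {a b : ℝ} (ha : 0 ≤ a) (hb : 0 ≤ b) :
    ∫⁻ t in Ioo (0 : ℝ) 1, ENNReal.ofReal (a * (1 - t) ^ (d + 1) + b * (1 - t) ^ d) =
      ENNReal.ofReal (a / (d + 2) + b / (d + 1)) := by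
  have hc : Continuous fun t : ℝ => a * (1 - t) ^ (d + 1) + b * (1 - t) ^ d := by fun_prop
  rw [← ofReal_integral_eq_lintegral_ofReal]
  · rw [← integral_Ioc_eq_integral_Ioo, ← intervalIntegral.integral_of_le zero_le_one,
      intervalIntegral.integral_comp_sub_left (fun t => a * t ^ (d + 1) + b * t ^ d),
      intervalIntegral.integral_add (by apply Continuous.intervalIntegrable; fun_prop)
        (by apply Continuous.intervalIntegrable; fun_prop)]
    simp only [intervalIntegral.integral_const_mul, integral_pow]
    congr 1
    push_cast
    simp
    ring
  · exact (hc.continuousOn.integrableOn_compact isCompact_Icc).mono_set Ioo_subset_Icc_self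
  · refine (ae_restrict_iff' measurableSet_Ioo).mpr (ae_of_all _ fun t ht => ?_)
    have : 0 ≤ 1 - t := by linarith [ht.2]
    simp only [Pi.zero_apply]
    positivity

end SymmetricBody

section SymmetricBody

open Filter Topology Pointwise

variable {E : Type*} [NormedAddCommGroup E] [InnerProductSpace ℝ E] {K L : Set E}

/-- The segment from `-u` to `u`. -/
def symmSegment (u : E) : Set E := (fun σ : ℝ => σ • u) '' Icc (-1) 1

theorem isCompact_symmSegment (u : E) : IsCompact (symmSegment u) :=
  isCompact_Icc.image (by fun_prop)

theorem symmSegment_nonempty (u : E) : (symmSegment u).Nonempty := ⟨_, 0, by norm_num, rfl⟩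

theorem neg_mem_symmSegment (u : E) : ∀ x ∈ symmSegment u, -x ∈ symmSegment u := by
  rintro _ ⟨σ, ⟨h1, h2⟩, rfl⟩
  exact ⟨-σ, ⟨by linarith, by linarith⟩, by simp⟩

theorem supAbs_symmSegment (u v : E) : supAbs (symmSegment u) v = |⟪u, v⟫| := by
  refine le_antisymm (supAbs_le (abs_nonneg _) ?_)
    (abs_inner_le_supAbs (isCompact_symmSegment u).isBounded v ⟨1, by norm_num, one_smul _ _⟩)
  rintro _ ⟨σ, hσ, rfl⟩
  rw [real_inner_smul_left, abs_mul]
  exact mul_le_of_le_one_left (abs_nonneg _) (abs_le.mpr hσ)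

/-- The Minkowski symmetrizations `(p + ρ q) / 2` of pairs of points of `K` on a common line in
direction `u`, where `ρ` is the reflection across the orthogonal complement of `u`. -/
def steinerSet (K : Set E) (u : E) : Set E :=
  {w | ∃ p ∈ K, ∃ q ∈ K, p - q ∈ ℝ ∙ u ∧ w = (1 / 2 : ℝ) • (p + (ℝ ∙ u)ᗮ.reflection q)}

theorem IsSymmBody.isCompact_steinerSet (hK : IsSymmBody K) (u : E) :
    IsCompact (steinerSet K u) := by
  have hcl : IsClosed {p : E × E | p.1 - p.2 ∈ ℝ ∙ u} :=
    (Submodule.closed_of_finiteDimensional (ℝ ∙ u)).preimage (by fun_prop)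
  have := ((hK.isCompact.prod hK.isCompact).inter_right hcl).image
    (f := fun p : E × E => (1 / 2 : ℝ) • (p.1 + (ℝ ∙ u)ᗮ.reflection p.2)) (by fun_prop)
  convert this using 1
  ext w
  constructor
  · rintro ⟨p, hp, q, hq, hpq, rfl⟩
    exact ⟨(p, q), ⟨⟨hp, hq⟩, hpq⟩, rfl⟩
  · rintro ⟨⟨p, q⟩, ⟨⟨hp, hq⟩, hpq⟩, rfl⟩
    exact ⟨p, hp, q, hq, hpq, rfl⟩

theorem IsSymmBody.neg_mem_steinerSet (hK : IsSymmBody K) (u : E) :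
    ∀ x ∈ steinerSet K u, -x ∈ steinerSet K u := by
  rintro _ ⟨p, hp, q, hq, hpq, rfl⟩
  refine ⟨-p, hK.neg_mem p hp, -q, hK.neg_mem q hq, ?_, ?_⟩
  · have := Submodule.neg_mem _ hpq
    rwa [neg_sub'] at this
  · rw [map_neg, ← smul_neg, neg_add]

theorem IsSymmBody.zero_mem (hK : IsSymmBody K) : (0 : E) ∈ K := mem_of_mem_nhds hK.mem_nhds

theorem IsSymmBody.steinerSet_nonempty (hK : IsSymmBody K) (u : E) : (steinerSet K u).Nonempty :=
  ⟨0, 0, hK.zero_mem, 0, hK.zero_mem, by simp, by simp⟩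

/-- A chord of `(t + ε) • K` in direction `u` with midpoint `μ` is, after a translation, contained
in `t • K + ε • steinerSet K u`. -/
theorem IsSymmBody.infGauge_steinerSet_le (hK : IsSymmBody K) (u : E) {t ε : ℝ} (ht : 0 < t)
    (hε : 0 ≤ ε) (y : (ℝ ∙ u)ᗮ) {s μ : ℝ} (h₁ : s ∈ fiber ((t + ε) • K) u y)
    (h₂ : 2 * μ - s ∈ fiber ((t + ε) • K) u y) :
    infGauge K (steinerSet K u) ε (y + (s - ε * μ / (t + ε)) • u) ≤ t := by
  have hpos : 0 < t + ε := by linarith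
  rw [mem_fiber, mem_smul_set_iff_inv_smul_mem₀ hpos.ne'] at h₁ h₂
  have hw : ((t + ε)⁻¹ • ((y : E) + (s - μ) • u)) ∈ steinerSet K u := by
    refine ⟨_, h₁, _, h₂, ?_, ?_⟩
    · rw [← smul_sub, add_sub_add_left_eq_sub, ← sub_smul, smul_smul]
      exact Submodule.smul_mem _ _ (Submodule.mem_span_singleton_self u)
    · rw [map_smul, map_add, map_smul, Submodule.reflection_mem_subspace_eq_self y.2,
        Submodule.reflection_orthogonalComplement_singleton_eq_neg]
      module
  refine (infGauge_le K ε _ hw).trans ?_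
  rw [hK.gauge_le_iff ht, mem_smul_set_iff_inv_smul_mem₀ ht.ne']
  convert h₁ using 1
  have : (t + ε)⁻¹ * t + (t + ε)⁻¹ * ε = 1 := by field_simp
  match_scalars
  · field_simp; ring
  · field_simp; ring

theorem pow_succ_add_le_add_pow (d : ℕ) {t ε : ℝ} (ht : 0 ≤ t) (hε : 0 ≤ ε) :
    t ^ (d + 1) + (d + 1) * ε * t ^ d ≤ (t + ε) ^ (d + 1) := by
  induction d with
  | zero => simp
  | succ d ih =>
    have h1 := mul_le_mul_of_nonneg_right ih (add_nonneg ht hε)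
    have h2 : 0 ≤ (d + 1) * ε * t ^ d * ε := by positivity
    push_cast
    calc t ^ (d + 1 + 1) + (d + 1 + 1) * ε * t ^ (d + 1)
        ≤ (t ^ (d + 1) + (d + 1) * ε * t ^ d) * (t + ε) := by
          ring_nf at h2 ⊢; nlinarith
      _ ≤ _ := h1
      _ = _ := by ring

variable [FiniteDimensional ℝ E] [MeasurableSpace E] [BorelSpace E]

theorem IsSymmBody.volume_smul_le (hK : IsSymmBody K) {u : E} (hu : ‖u‖ = 1) {t ε : ℝ}
    (ht : 0 < t) (hε : 0 ≤ ε) :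
    volume ((t + ε) • K) ≤ volume {x | infGauge K (steinerSet K u) ε x ≤ t} := by
  have hA : MeasurableSet {x | infGauge K (steinerSet K u) ε x ≤ t} :=
    (isClosed_le (hK.continuous_infGauge (hK.isCompact_steinerSet u) ε)
      continuous_const).measurableSet
  have hS : IsCompact ((t + ε) • K) := hK.isCompact.smul _
  rw [volume_eq_lintegral_fiber hu hA, volume_eq_lintegral_fiber hu hS.isClosed.measurableSet]
  refine lintegral_mono fun y => ?_
  rcases (fiber ((t + ε) • K) u y).eq_empty_or_nonempty with he | hne
  · simp [he]
  have hI := eq_Icc_of_connected_compact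
    ⟨hne, ((hK.convex.smul (t + ε)).fiber u y).isPreconnected⟩ (hS.fiber hu y)
  set a := sInf (fiber ((t + ε) • K) u y)
  set b := sSup (fiber ((t + ε) • K) u y)
  set m := ε * ((a + b) / 2) / (t + ε)
  calc volume (fiber ((t + ε) • K) u y)
      = volume ((fun s => s - m) ⁻¹' ((fun s => s + m) ⁻¹' fiber ((t + ε) • K) u y)) := by
        rw [← preimage_comp]; congr 1; ext s; simp
    _ = volume ((fun s => s + m) ⁻¹' fiber ((t + ε) • K) u y) := by
        simp_rw [sub_eq_add_neg]; exact measure_preimage_add_right volume (-m) _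
    _ ≤ _ := measure_mono fun s hs => ?_
  rw [mem_preimage] at hs
  have := hK.infGauge_steinerSet_le u ht hε y (s := s + m) (μ := (a + b) / 2) hs (by
    rw [hI] at hs ⊢
    constructor <;> linarith [hs.1, hs.2])
  rw [add_sub_assoc, sub_self, add_zero] at this
  exact this

variable {d : ℕ}

theorem IsSymmBody.volume_smul (hK : IsSymmBody K) (hd : Module.finrank ℝ E = d + 1) {t : ℝ}
    (ht : 0 ≤ t) : volume (t • K) = ENNReal.ofReal (volume.real K * t ^ (d + 1)) := by
  rw [Measure.addHaar_smul, hd, abs_of_nonneg (by positivity), mul_comm,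
    ENNReal.ofReal_mul measureReal_nonneg, ofReal_measureReal hK.isCompact.measure_lt_top.ne]

theorem IsSymmBody.integral_posPart_one_sub_gauge (hK : IsSymmBody K)
    (hd : Module.finrank ℝ E = d + 1) :
    ∫ x, max (1 - gauge K x) 0 = volume.real K / (d + 2) := by
  have h := ofReal_integral_posPart_one_sub (G := gauge K) (fun x => gauge_nonneg x)
    hK.integrable_posPart_one_sub_gauge
  have h2 := lintegral_Ioo_ofReal_pow d (a := volume.real K) (b := 0) measureReal_nonneg le_rfl
  rw [setLIntegral_congr_fun (g := fun t => ENNReal.ofReal (volume.real K * (1 - t) ^ (d + 1) +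
    0 * (1 - t) ^ d)) measurableSet_Ioo, h2, zero_div, add_zero] at h
  · exact (ENNReal.ofReal_eq_ofReal_iff (integral_nonneg fun x => le_max_right _ _)
      (by positivity)).mp h
  · intro t ht
    have h1 : 0 < 1 - t := by linarith [ht.2]
    have : {x | gauge K x ≤ 1 - t} = (1 - t) • K := by
      ext x; exact hK.gauge_le_iff h1 x
    simp only [this, hK.volume_smul hd h1.le, zero_mul, add_zero]

theorem IsSymmBody.le_integral_supAbs_steinerSet (hK : IsSymmBody K)
    (hd : Module.finrank ℝ E = d + 1) {u : E} (hu : ‖u‖ = 1) :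
    volume.real K ≤ ∫ x in K, supAbs (steinerSet K u) (gradient (gauge K) x) := by
  have hlim := hK.tendsto_integral_slope (hK.isCompact_steinerSet u) (hK.steinerSet_nonempty u)
    (hK.neg_mem_steinerSet u)
  refine ge_of_tendsto hlim ?_
  filter_upwards [self_mem_nhdsWithin] with ε hε
  have hε : 0 < ε := hε
  have hnn : 0 ≤ ∫ x, max (1 - infGauge K (steinerSet K u) ε x) 0 :=
    integral_nonneg fun x => le_max_right _ _
  rw [le_div_iff₀ hε, le_sub_iff_add_le, hK.integral_posPart_one_sub_gauge hd,
    ← ENNReal.ofReal_le_ofReal_iff hnn,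
    ofReal_integral_posPart_one_sub (fun x => infGauge_nonneg _ _ _ _)
      (hK.integrable_posPart_one_sub_infGauge (hK.isCompact_steinerSet u)
        (hK.steinerSet_nonempty u) hε.le)]
  have h2 := lintegral_Ioo_ofReal_pow d (a := volume.real K) (b := (d + 1) * ε * volume.real K)
    measureReal_nonneg (by positivity)
  calc _ = ENNReal.ofReal (volume.real K / (d + 2) + (d + 1) * ε * volume.real K / (d + 1)) := by
        congr 1; field_simp; ring
    _ = _ := h2.symm
    _ ≤ _ := setLIntegral_mono' measurableSet_Ioo fun t ht => ?_
  have h1 : 0 < 1 - t := by linarith [ht.2]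
  refine le_trans ?_ (hK.volume_smul_le hu h1 hε.le)
  rw [hK.volume_smul hd (by positivity)]
  refine ENNReal.ofReal_le_ofReal ?_
  have := mul_le_mul_of_nonneg_left (pow_succ_add_le_add_pow d h1.le hε.le)
    (measureReal_nonneg (μ := volume) (s := K))
  linarith

theorem IsSymmBody.volume_shadow_smul (hK : IsSymmBody K) (hd : Module.finrank ℝ E = d + 1)
    {u : E} (hu : ‖u‖ = 1) {t : ℝ} (ht : 0 < t) :
    volume (shadow (t • K) u) = ENNReal.ofReal (volume.real (shadow K u) * t ^ d) := by
  have : Fact (Module.finrank ℝ E = d + 1) := ⟨hd⟩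
  have hu0 : u ≠ 0 := by
    rintro rfl; simp at hu
  rw [shadow_smul K u ht.ne', Measure.addHaar_smul,
    Submodule.finrank_orthogonal_span_singleton (n := d) hu0, abs_of_nonneg (by positivity),
    mul_comm, ENNReal.ofReal_mul measureReal_nonneg,
    ofReal_measureReal (hK.isCompact.shadow hu).measure_lt_top.ne]

theorem IsSymmBody.integral_abs_inner_gradient (hK : IsSymmBody K)
    (hd : Module.finrank ℝ E = d + 1) {u : E} (hu : ‖u‖ = 1) :
    ∫ x in K, |⟪u, gradient (gauge K) x⟫| = 2 * volume.real (shadow K u) / (d + 1) := by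
  have hlim := hK.tendsto_integral_slope (isCompact_symmSegment u) (symmSegment_nonempty u)
    (neg_mem_symmSegment u)
  simp_rw [supAbs_symmSegment] at hlim
  refine tendsto_nhds_unique hlim (tendsto_const_nhds.congr' ?_)
  filter_upwards [self_mem_nhdsWithin] with ε hε
  have hε : 0 < ε := hε
  have hnn : 0 ≤ ∫ x, max (1 - infGauge K (symmSegment u) ε x) 0 :=
    integral_nonneg fun x => le_max_right _ _
  have h := ofReal_integral_posPart_one_sub (fun x => infGauge_nonneg K (symmSegment u) ε x)
      (hK.integrable_posPart_one_sub_infGauge (isCompact_symmSegment u)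
        (symmSegment_nonempty u) hε.le)
  have h2 := lintegral_Ioo_ofReal_pow d (a := volume.real K)
    (b := 2 * ε * volume.real (shadow K u)) measureReal_nonneg (by positivity)
  rw [setLIntegral_congr_fun (g := fun t => ENNReal.ofReal (volume.real K * (1 - t) ^ (d + 1) +
    2 * ε * volume.real (shadow K u) * (1 - t) ^ d)) measurableSet_Ioo, h2,
    ENNReal.ofReal_eq_ofReal_iff hnn (by positivity)] at h
  · rw [h, hK.integral_posPart_one_sub_gauge hd]
    field_simp
    ring
  · intro t ht
    have h1 : 0 < 1 - t := by linarith [ht.2]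
    have hset : {x | infGauge K (symmSegment u) ε x ≤ 1 - t} =
        {x : E | ∃ σ ∈ Icc (-1 : ℝ) 1, x - (ε * σ) • u ∈ (1 - t) • K} := by
      ext x
      rw [mem_ofPred_eq,
        hK.infGauge_le_iff (isCompact_symmSegment u) (symmSegment_nonempty u)]
      simp [symmSegment, smul_smul, hK.gauge_le_iff h1]
    simp only [hset]
    rw [volume_segment_thickening (hK.isCompact.smul _) (hK.convex.smul _) hu hε.le,
      hK.volume_smul hd h1.le, hK.volume_shadow_smul hd hu h1, ← ENNReal.ofReal_mul (by positivity),
      ← ENNReal.ofReal_add (by positivity) (by positivity)]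
    congr 1; ring

end SymmetricBody

section SymmetricBody

open Filter Topology Pointwise

variable {E : Type*} [NormedAddCommGroup E] [InnerProductSpace ℝ E] {K L : Set E}

theorem continuous_supAbs (hL : Bornology.IsBounded L) : Continuous (supAbs L) := by
  obtain ⟨R, hR⟩ := hL.exists_norm_le
  have key (v w : E) : supAbs L v ≤ supAbs L w + max R 0 * ‖v - w‖ := by
    refine supAbs_le (add_nonneg (supAbs_nonneg _ _) (by positivity)) fun x hx => ?_
    have h1 := abs_inner_le_supAbs hL w hx
    have h2 := abs_real_inner_le_norm x (v - w)
    have h3 := mul_le_mul_of_nonneg_right ((hR x hx).trans (le_max_left R 0)) (norm_nonneg (v - w))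
    have h4 : ⟪x, v⟫ = ⟪x, w⟫ + ⟪x, v - w⟫ := by rw [inner_sub_right]; ring
    rw [h4]
    exact (abs_add_le _ _).trans (by linarith)
  refine (LipschitzWith.of_dist_le_mul (K := (max R 0).toNNReal) fun v w => ?_).continuous
  rw [Real.coe_toNNReal _ (le_max_right _ _), Real.dist_eq, dist_eq_norm, abs_le]
  have h1 := key v w
  have h2 := key w v
  rw [norm_sub_rev] at h2
  constructor <;> linarith

theorem supAbs_smul (L : Set E) (s : ℝ) (v : E) : supAbs L (s • v) = |s| * supAbs L v := by
  simp only [supAbs, inner_smul_right, abs_mul, Real.mul_iSup_of_nonneg (abs_nonneg s)]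

theorem supAbs_steinerSet_le (hK : Bornology.IsBounded K) (u v : E) :
    supAbs (steinerSet K u) v ≤
      (1 / 2) * (supAbs K v + supAbs K ((ℝ ∙ u)ᗮ.reflection v)) := by
  refine supAbs_le (by have := supAbs_nonneg K v; have := supAbs_nonneg K ((ℝ ∙ u)ᗮ.reflection v)
                       positivity) ?_
  rintro _ ⟨p, hp, q, hq, -, rfl⟩
  have h1 := abs_inner_le_supAbs hK v hp
  have h2 := abs_inner_le_supAbs hK ((ℝ ∙ u)ᗮ.reflection v) hq
  have h3 : ⟪(ℝ ∙ u)ᗮ.reflection q, v⟫ = ⟪q, (ℝ ∙ u)ᗮ.reflection v⟫ := by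
    rw [← LinearIsometryEquiv.inner_map_map (ℝ ∙ u)ᗮ.reflection q, Submodule.reflection_reflection]
  rw [real_inner_smul_left, inner_add_left, h3, abs_mul, abs_of_pos (by norm_num : (0 : ℝ) < 1 / 2)]
  have := abs_add_le ⟪p, v⟫ ⟪q, (ℝ ∙ u)ᗮ.reflection v⟫
  linarith

variable [FiniteDimensional ℝ E]

theorem IsSymmBody.supAbs_gradient_gauge_le_one (hK : IsSymmBody K) (x : E) :
    supAbs K (gradient (gauge K) x) ≤ 1 := by
  by_cases hx : DifferentiableAt ℝ (gauge K) x
  · refine le_of_tendsto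
      (hK.tendsto_infGauge_slope hK.isCompact ⟨0, hK.zero_mem⟩ hK.neg_mem hx) ?_
    filter_upwards [self_mem_nhdsWithin] with ε hε
    have hε : 0 < ε := hε
    have h := hK.abs_infGauge_sub_le hK.isCompact ⟨0, hK.zero_mem⟩
      (fun w hw => (hK.gauge_le_one_iff w).mpr hw) hε.le x
    rw [div_le_iff₀ hε]
    linarith [(abs_le.mp h).1]
  · rw [gradient_eq_zero_of_not_differentiableAt hx]
    exact supAbs_le zero_le_one fun y _ => by simp

theorem IsSymmBody.exists_norm_gradient_gauge_le (hK : IsSymmBody K) :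
    ∃ C : ℝ, ∀ x, ‖gradient (gauge K) x‖ ≤ C := by
  obtain ⟨C, hC⟩ := hK.convex.lipschitz_gauge hK.mem_nhds
  refine ⟨C, fun x => ?_⟩
  rw [gradient, LinearIsometryEquiv.norm_map]
  exact norm_fderiv_le_of_lipschitz ℝ hC

/-- If all the points `h(u) u`, `‖u‖ = 1`, belong to `K`, where `h` is the support function of `K`,
then `K` is a ball. -/
theorem IsSymmBody.exists_eq_closedBall_of_supAbs_smul_mem (hK : IsSymmBody K)
    (hd : 1 < Module.finrank ℝ E) (h : ∀ u : E, ‖u‖ = 1 → supAbs K u • u ∈ K) :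
    ∃ R, 0 ≤ R ∧ K = closedBall 0 R := by
  obtain ⟨M, hM⟩ := hK.isCompact.isBounded.exists_norm_le
  have hM0 : 0 ≤ M := (norm_nonneg _).trans (hM 0 hK.zero_mem)
  set f : E → ℝ := fun x => supAbs K x / ‖x‖ with hf
  have hf0 (x : E) : 0 ≤ f x := div_nonneg (supAbs_nonneg _ _) (norm_nonneg _)
  have hmem {x : E} (hx : x ≠ 0) : (f x * ‖x‖⁻¹) • x ∈ K := by
    have hx' : 0 < ‖x‖ := norm_pos_iff.mpr hx
    have := h (‖x‖⁻¹ • x) (by rw [norm_smul, norm_inv, norm_norm, inv_mul_cancel₀ hx'.ne'])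
    rwa [supAbs_smul, abs_of_pos (inv_pos.mpr hx'), smul_smul, mul_comm ‖x‖⁻¹ (supAbs K x),
      ← div_eq_mul_inv] at this
  have hfM {x : E} (hx : x ≠ 0) : f x ≤ M := by
    have hx' : 0 < ‖x‖ := norm_pos_iff.mpr hx
    have := hM _ (hmem hx)
    rwa [norm_smul, norm_mul, norm_inv, norm_norm, inv_mul_cancel_right₀ hx'.ne',
      Real.norm_of_nonneg (hf0 x)] at this
  have hle {x y : E} (hx : x ≠ 0) (hy : y ≠ 0) :
      f x - f y ≤ M * ‖y - x‖ ^ 2 / (2 * (‖x‖ * ‖y‖)) := by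
    have hx' : 0 < ‖x‖ := norm_pos_iff.mpr hx
    have hy' : 0 < ‖y‖ := norm_pos_iff.mpr hy
    have h1 := (le_abs_self _).trans (abs_inner_le_supAbs hK.isCompact.isBounded y (hmem hx))
    have h2 : supAbs K y = f y * ‖y‖ := by simp only [hf]; field_simp
    rw [real_inner_smul_left, h2] at h1
    have h3 := norm_sub_sq_real y x
    rw [real_inner_comm] at h3
    have h4 : f x * ⟪x, y⟫ ≤ f y * (‖x‖ * ‖y‖) := by
      have := mul_le_mul_of_nonneg_right h1 hx'.le
      calc f x * ⟪x, y⟫ = f x * ‖x‖⁻¹ * ⟪x, y⟫ * ‖x‖ := by field_simp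
        _ ≤ _ := this
        _ = _ := by ring
    rw [le_div_iff₀ (by positivity)]
    have h5 : 2 * (‖x‖ * ‖y‖ - ⟪x, y⟫) ≤ ‖y - x‖ ^ 2 := by nlinarith [sq_nonneg (‖x‖ - ‖y‖)]
    have h6 := mul_le_mul_of_nonneg_left h5 (hf0 x)
    have h7 := mul_le_mul_of_nonneg_right (hfM hx) (sq_nonneg ‖y - x‖)
    nlinarith
  have habs {x y : E} (hx : x ≠ 0) (hy : y ≠ 0) :
      |f y - f x| ≤ M * ‖y - x‖ ^ 2 / (2 * (‖x‖ * ‖y‖)) := by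
    have h1 := hle hx hy
    have h2 := hle hy hx
    rw [norm_sub_rev, mul_comm ‖y‖ ‖x‖] at h2
    rw [abs_le]; constructor <;> linarith
  have hderiv (x : E) (hx : x ≠ 0) : HasFDerivAt f (0 : E →L[ℝ] ℝ) x := by
    have hx' : 0 < ‖x‖ := norm_pos_iff.mpr hx
    have hO : (fun y => f y - f x) =O[𝓝 x] fun y => ‖y - x‖ ^ 2 := by
      refine Asymptotics.IsBigO.of_bound (M / ‖x‖ ^ 2) ?_
      filter_upwards [continuous_norm.continuousAt.eventually_const_lt
        (show ‖x‖ / 2 < ‖x‖ by linarith)] with y hy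
      have hy0 : y ≠ 0 := by
        rintro rfl; rw [norm_zero] at hy; linarith
      refine (habs hx hy0).trans ?_
      rw [norm_pow, norm_norm, div_mul_eq_mul_div]
      refine div_le_div_of_nonneg_left (by positivity) (by positivity) ?_
      nlinarith
    simpa using (hO.hasFDerivAt (𝕜 := ℝ) one_lt_two).add_const (f x)
  have hconn : IsPreconnected ({0}ᶜ : Set E) :=
    (isConnected_compl_singleton_of_one_lt_rank (by
      rw [← Module.finrank_eq_rank]; exact_mod_cast hd) (0 : E)).isPreconnected
  have : Nontrivial E := Module.nontrivial_of_finrank_pos (R := ℝ) (by lia)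
  obtain ⟨e, he⟩ := exists_ne (0 : E)
  have hconst (x : E) (hx : x ≠ 0) : f x = f e :=
    isOpen_compl_singleton.is_const_of_fderiv_eq_zero hconn
      (fun x hx => (hderiv x hx).differentiableAt.differentiableWithinAt)
      (fun x hx => (hderiv x hx).fderiv) hx he
  refine ⟨f e, hf0 e, Subset.antisymm (fun x hx => ?_) fun x hx => ?_⟩
  · rw [mem_closedBall_zero_iff]
    rcases eq_or_ne x 0 with rfl | hx0
    · simpa using hf0 e
    rw [← hconst x hx0, le_div_iff₀ (norm_pos_iff.mpr hx0), ← real_inner_self_eq_norm_mul_norm]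
    exact (le_abs_self _).trans (abs_inner_le_supAbs hK.isCompact.isBounded x hx)
  · rw [mem_closedBall_zero_iff] at hx
    rcases eq_or_ne x 0 with rfl | hx0
    · exact hK.zero_mem
    have hx' : 0 < ‖x‖ := norm_pos_iff.mpr hx0
    have hR : 0 < f e := hx'.trans_le hx
    have := hK.convex.smul_mem_of_zero_mem hK.zero_mem (hmem hx0) (t := ‖x‖ / f e)
      ⟨by positivity, (div_le_one hR).mpr hx⟩
    rwa [hconst x hx0, smul_smul, ← mul_assoc, div_mul_cancel₀ _ hR.ne',
      mul_inv_cancel₀ hx'.ne', one_smul] at this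

variable [MeasurableSpace E] [BorelSpace E]

theorem IsSymmBody.integral_supAbs_gradient_gauge_le (hK : IsSymmBody K) :
    ∫ x in K, supAbs K (gradient (gauge K) x) ≤ volume.real K := by
  refine (le_abs_self _).trans ?_
  have := norm_setIntegral_le_of_norm_le_const (μ := volume) (C := 1)
    (f := fun x => supAbs K (gradient (gauge K) x)) hK.isCompact.measure_lt_top
    fun x _ => by
      rw [Real.norm_of_nonneg (supAbs_nonneg _ _)]
      exact hK.supAbs_gradient_gauge_le_one x
  simpa using this

theorem measurable_gradient_real (f : E → ℝ) : Measurable (gradient f) :=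
  (InnerProductSpace.toDual ℝ E).symm.continuous.measurable.comp (measurable_fderiv ℝ f)

end SymmetricBody

section ConstantBrightness

variable {ι : Type*} [Fintype ι] {K : Set (EuclideanSpace ℝ ι)} {d : ℕ} {c : ℝ}

/-- For a body of constant brightness, integrals of support functions against the distribution of
the gradient of the gauge are multiples of integrals over the unit ball. -/
theorem IsSymmBody.exists_integral_supAbs_gradient_eq (hK : IsSymmBody K)
    (hd : Module.finrank ℝ (EuclideanSpace ℝ ι) = d + 1)
    (hc : ∀ u, ‖u‖ = 1 → volume.real (shadow K u) = c) :
    ∃ C : ℝ, 0 ≤ C ∧ ∀ L : Set (EuclideanSpace ℝ ι), Bornology.IsBounded L →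
      ∫ x in K, supAbs L (gradient (gauge K) x) = C * ∫ z in ball 0 1, supAbs L z := by
  have : Nontrivial (EuclideanSpace ℝ ι) :=
    Module.nontrivial_of_finrank_pos (R := ℝ) (hd ▸ d.succ_pos)
  obtain ⟨e, he⟩ := exists_norm_eq (EuclideanSpace ℝ ι) (zero_le_one : (0 : ℝ) ≤ 1)
  have hc0 : 0 ≤ c := hc e he ▸ measureReal_nonneg
  obtain ⟨c₁, hc₁, hball⟩ := exists_integral_abs_inner_ball_eq (F := EuclideanSpace ℝ ι)
  have hCnn : 0 ≤ 2 * c / ((d + 1) * c₁) := by positivity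
  obtain ⟨M, hM⟩ := hK.exists_norm_gradient_gauge_le
  have hG : Measurable (gradient (gauge K)) := measurable_gradient_real _
  have hfin : IsFiniteMeasure (volume.restrict K) :=
    ⟨by rw [Measure.restrict_apply_univ]; exact hK.isCompact.measure_lt_top⟩
  have hfin' : IsFiniteMeasure (volume.restrict (ball (0 : EuclideanSpace ℝ ι) 1)) :=
    ⟨by rw [Measure.restrict_apply_univ]; exact measure_ball_lt_top⟩
  refine ⟨_, hCnn, fun L hL => ?_⟩
  have key := integral_supAbs_eq (μ₁ := (volume.restrict K).map (gradient (gauge K)))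
    (μ₂ := (2 * c / ((d + 1) * c₁)).toNNReal • volume.restrict (ball (0 : EuclideanSpace ℝ ι) 1))
    ?_ ?_ (fun u => ?_) hL
  · rwa [integral_map hG.aemeasurable (continuous_supAbs hL).aestronglyMeasurable,
      integral_smul_nnreal_measure, NNReal.smul_def, Real.coe_toNNReal _ hCnn, smul_eq_mul] at key
  · rw [integrable_map_measure continuous_norm.aestronglyMeasurable hG.aemeasurable]
    exact Integrable.of_bound (hG.norm.aestronglyMeasurable) M (by simpa using .of_forall hM)
  · refine Integrable.smul_measure_nnreal ?_
    exact (continuous_norm.continuousOn.integrableOn_compact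
      (isCompact_closedBall 0 1)).mono_set ball_subset_closedBall
  · have hcont : Continuous fun v => |⟪u, v⟫| := by fun_prop
    rw [integral_map hG.aemeasurable hcont.aestronglyMeasurable,
      integral_smul_nnreal_measure, NNReal.smul_def, Real.coe_toNNReal _ hCnn, smul_eq_mul]
    simp_rw [real_inner_comm _ u] at hball ⊢
    rw [hball]
    rcases eq_or_ne u 0 with rfl | hu
    · simp
    have hu' : 0 < ‖u‖ := norm_pos_iff.mpr hu
    have hn : ‖‖u‖⁻¹ • u‖ = 1 := by rw [norm_smul, norm_inv, norm_norm, inv_mul_cancel₀ hu'.ne']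
    have h1 := hK.integral_abs_inner_gradient hd hn
    rw [hc _ hn] at h1
    simp_rw [real_inner_smul_left, abs_mul, abs_inv, abs_norm, integral_const_mul] at h1
    rw [inv_mul_eq_iff_eq_mul₀ hu'.ne'] at h1
    simp_rw [real_inner_comm u] at h1 ⊢
    rw [h1]
    field_simp

/-- An origin-symmetric convex body all of whose shadows have the same volume is a ball. -/
theorem IsSymmBody.exists_eq_closedBall (hK : IsSymmBody K)
    (hd : Module.finrank ℝ (EuclideanSpace ℝ ι) = d + 1) (hd1 : 1 ≤ d)
    (hc : ∀ u, ‖u‖ = 1 → volume.real (shadow K u) = c) : ∃ R, 0 ≤ R ∧ K = closedBall 0 R := by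
  obtain ⟨C, hC0, hC⟩ := hK.exists_integral_supAbs_gradient_eq hd hc
  have hbK := hK.isCompact.isBounded
  have hvol : 0 < volume.real K :=
    ENNReal.toReal_pos (Measure.measure_pos_of_mem_nhds _ hK.mem_nhds).ne'
      hK.isCompact.measure_lt_top.ne
  refine hK.exists_eq_closedBall_of_supAbs_smul_mem (by rw [hd]; lia) fun u hu => ?_
  have hcL := hK.isCompact_steinerSet u
  have h1 := hK.le_integral_supAbs_steinerSet hd hu
  have h2 := hK.integral_supAbs_gradient_gauge_le
  rw [hC _ hcL.isBounded] at h1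
  rw [hC _ hbK] at h2
  have hCpos : 0 < C := by
    refine hC0.lt_of_ne ?_
    rintro rfl
    rw [zero_mul] at h1
    linarith
  have hint {f : EuclideanSpace ℝ ι → ℝ} (hf : Continuous f) : IntegrableOn f (ball 0 1) :=
    (hf.continuousOn.integrableOn_compact (isCompact_closedBall 0 1)).mono_set
      ball_subset_closedBall
  set ρ := (ℝ ∙ u)ᗮ.reflection
  have hKc := continuous_supAbs hbK
  have hLc := continuous_supAbs hcL.isBounded
  have hρ : ∫ z in ball 0 1, supAbs K (ρ z) = ∫ z in ball 0 1, supAbs K z := by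
    have hp : ρ ⁻¹' ball (0 : EuclideanSpace ℝ ι) 1 = ball 0 1 := by
      ext z; simp
    have := ρ.measurePreserving.setIntegral_preimage_emb ρ.toHomeomorph.measurableEmbedding
      (supAbs K) (ball 0 1)
    rwa [hp] at this
  set A : EuclideanSpace ℝ ι → ℝ := fun z => (1 / 2) * (supAbs K z + supAbs K (ρ z))
  have hAc : Continuous A := by
    have := ρ.continuous
    fun_prop
  have hKρ : Continuous fun z => supAbs K (ρ z) := hKc.comp ρ.continuous
  have hA : ∫ z in ball 0 1, A z = ∫ z in ball 0 1, supAbs K z := by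
    simp only [A]
    rw [integral_const_mul, integral_add (hint hKc) (hint hKρ), hρ]
    ring
  have hLA (z) : supAbs (steinerSet K u) z ≤ A z := supAbs_steinerSet_le hbK u z
  have hzero : ∫ z in ball 0 1, (A z - supAbs (steinerSet K u) z) = 0 := by
    refine le_antisymm ?_ (integral_nonneg fun z => sub_nonneg.mpr (hLA z))
    rw [integral_sub (hint hAc) (hint hLc), hA]
    have := le_of_mul_le_mul_left (h2.trans h1) hCpos
    linarith
  rw [integral_eq_zero_iff_of_nonneg (fun z => sub_nonneg.mpr (hLA z)) (hint (hAc.sub hLc))]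
    at hzero
  have heq := Measure.eqOn_open_of_ae_eq hzero isOpen_ball (hAc.sub hLc).continuousOn
    continuousOn_const
  have hmem : (1 / 2 : ℝ) • u ∈ ball (0 : EuclideanSpace ℝ ι) 1 := by
    rw [mem_ball_zero_iff, norm_smul, hu]; norm_num
  have hρu : ρ u = -u := Submodule.reflection_orthogonalComplement_singleton_eq_neg u
  have hNL : supAbs K u = supAbs (steinerSet K u) u := by
    have := sub_eq_zero.mp (heq hmem)
    simp only [A, map_smul, hρu, supAbs_smul, ← neg_one_smul ℝ u] at this
    norm_num at this
    linarith
  obtain ⟨w, hw, hmax⟩ := hcL.exists_isMaxOn (hK.steinerSet_nonempty u)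
    (f := fun w => |⟪w, u⟫|) (by fun_prop)
  have hNw : supAbs (steinerSet K u) u = |⟪w, u⟫| :=
    le_antisymm (supAbs_le (abs_nonneg _) fun x hx => hmax hx)
      (abs_inner_le_supAbs hcL.isBounded u hw)
  obtain ⟨p, hp, q, hq, hpq, rfl⟩ := hw
  obtain ⟨a, ha⟩ := Submodule.mem_span_singleton.mp hpq
  have hρq : ⟪ρ q, u⟫ = -⟪q, u⟫ := by
    rw [← LinearIsometryEquiv.inner_map_map ρ q u, hρu, inner_neg_right, neg_neg]
  have haK : (a / 2) • u ∈ K := by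
    have := hK.convex hp (hK.neg_mem q hq) (by norm_num : (0 : ℝ) ≤ 1 / 2)
      (by norm_num : (0 : ℝ) ≤ 1 / 2) (by norm_num)
    rwa [← smul_add, ← sub_eq_add_neg, ← ha, smul_smul, one_div_mul_eq_div] at this
  have hval : supAbs K u = |a / 2| := by
    rw [hNL, hNw, real_inner_smul_left, inner_add_left, hρq, ← sub_eq_add_neg, ← inner_sub_left,
      ← ha, real_inner_smul_left, real_inner_self_eq_norm_sq, hu]
    congr 1; ring
  rw [hval]
  rcases abs_choice (a / 2) with h | h <;> rw [h]
  · exact haK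
  · rw [neg_smul]
    exact hK.neg_mem _ haK

end ConstantBrightness

section Sphere

open Filter Topology

variable {E : Type*} [NormedAddCommGroup E] [InnerProductSpace ℝ E]

/-- The parametrization of the upper half of the unit sphere with pole `u` as a graph over the
orthogonal complement of `u`. -/
def hemisphereGraph (u : E) (y : (ℝ ∙ u)ᗮ) : E := y + √(1 - ‖y‖ ^ 2) • u

theorem continuous_hemisphereGraph (u : E) : Continuous (hemisphereGraph u) := by
  unfold hemisphereGraph; fun_prop

theorem hemisphereGraph_zero (u : E) : hemisphereGraph u 0 = u := by simp [hemisphereGraph]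

theorem contDiffAt_hemisphereGraph (u : E) : ContDiffAt ℝ 1 (hemisphereGraph u) 0 := by
  have h : ContDiffAt ℝ 1 (fun y : (ℝ ∙ u)ᗮ => √(1 - ‖y‖ ^ 2)) 0 :=
    (contDiffAt_const.sub (contDiff_norm_sq ℝ).contDiffAt).sqrt (by simp)
  exact (ℝ ∙ u)ᗮ.subtypeL.contDiff.contDiffAt.add (h.smul contDiffAt_const)

theorem hemisphereGraph_mem_sphere {u : E} (hu : ‖u‖ = 1) {y : (ℝ ∙ u)ᗮ} (hy : ‖y‖ ≤ 1) :
    hemisphereGraph u y ∈ sphere (0 : E) 1 := by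
  have h := norm_sq_add_smul hu y √(1 - ‖y‖ ^ 2)
  rw [Real.sq_sqrt (by nlinarith [norm_nonneg y]), add_sub_cancel] at h
  rw [mem_sphere_zero_iff_norm, ← sq_eq_sq₀ (norm_nonneg _) zero_le_one, one_pow]
  exact h

theorem orthogonalProjectionOnto_add_inner_smul {u : E} (hu : ‖u‖ = 1) (x : E) :
    ((ℝ ∙ u)ᗮ.orthogonalProjectionOnto x : E) + ⟪x, u⟫ • u = x := by
  have h := (ℝ ∙ u).starProjection_add_starProjection_orthogonal x
  rw [Submodule.starProjection_unit_singleton ℝ hu, real_inner_comm, add_comm] at h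
  exact h

theorem orthogonalProjectionOnto_add_smul (u : E) (y : (ℝ ∙ u)ᗮ) (s : ℝ) :
    (ℝ ∙ u)ᗮ.orthogonalProjectionOnto (y + s • u) = y := by
  rw [map_add, Submodule.orthogonalProjectionOnto_mem_subspace_eq_self, map_smul,
    (Submodule.orthogonalProjectionOnto_eq_zero_iff).mpr
      (Submodule.le_orthogonal_orthogonal _ (Submodule.mem_span_singleton_self u)),
    smul_zero, add_zero]

theorem hemisphereGraph_orthogonalProjectionOnto {u : E} (hu : ‖u‖ = 1) {x : E} (hx : ‖x‖ = 1)
    (hxu : 0 ≤ ⟪x, u⟫) : hemisphereGraph u ((ℝ ∙ u)ᗮ.orthogonalProjectionOnto x) = x := by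
  have h1 := orthogonalProjectionOnto_add_inner_smul hu x
  have h2 := norm_sq_add_smul hu ((ℝ ∙ u)ᗮ.orthogonalProjectionOnto x) ⟪x, u⟫
  rw [h1, hx] at h2
  have h3 : √(1 - ‖(ℝ ∙ u)ᗮ.orthogonalProjectionOnto x‖ ^ 2) = ⟪x, u⟫ := by
    rw [Real.sqrt_eq_iff_mul_self_eq (by nlinarith [sq_nonneg ⟪x, u⟫]) hxu]
    linarith
  rw [hemisphereGraph, h3, h1]

variable [FiniteDimensional ℝ E] [MeasurableSpace E] [BorelSpace E] {d : ℕ}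

theorem isAddHaarMeasure_hausdorffMeasure_orthogonal (hd : Module.finrank ℝ E = d + 1) {u : E}
    (hu : ‖u‖ = 1) : (μH[(d : ℝ)] : Measure (ℝ ∙ u)ᗮ).IsAddHaarMeasure := by
  have : Fact (Module.finrank ℝ E = d + 1) := ⟨hd⟩
  have hu0 : u ≠ 0 := by
    rintro rfl; simp at hu
  rw [← Submodule.finrank_orthogonal_span_singleton (𝕜 := ℝ) (n := d) hu0]
  exact isAddHaarMeasure_hausdorffMeasure

theorem hausdorffMeasure_sphere_lt_top (hd : Module.finrank ℝ E = d + 1) :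
    μH[(d : ℝ)] (sphere (0 : E) 1) < ∞ := by
  refine (isCompact_sphere (0 : E) 1).measure_lt_top_of_nhdsWithin fun u hu => ?_
  rw [mem_sphere_zero_iff_norm] at hu
  have := isAddHaarMeasure_hausdorffMeasure_orthogonal hd hu
  obtain ⟨C, t, ht, hC⟩ := (contDiffAt_hemisphereGraph u).exists_lipschitzOnWith
  have ht' : t ∩ closedBall 0 1 ∈ 𝓝 (0 : (ℝ ∙ u)ᗮ) :=
    inter_mem ht (closedBall_mem_nhds _ one_pos)
  refine ⟨hemisphereGraph u '' (t ∩ closedBall 0 1), ?_, ?_⟩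
  · have hPu : (ℝ ∙ u)ᗮ.orthogonalProjectionOnto u = 0 := by
      simp
    have h1 : ∀ᶠ x in 𝓝 u, (ℝ ∙ u)ᗮ.orthogonalProjectionOnto x ∈ t ∩ closedBall 0 1 :=
      (ℝ ∙ u)ᗮ.orthogonalProjectionOnto.continuous.continuousAt.preimage_mem_nhds (by rwa [hPu])
    have h2 : ∀ᶠ x in 𝓝 u, 0 < ⟪x, u⟫ := by
      have hc : Continuous fun x : E => ⟪x, u⟫ := by fun_prop
      refine hc.continuousAt.eventually_const_lt ?_
      simp [hu]
    filter_upwards [nhdsWithin_le_nhds h1, nhdsWithin_le_nhds h2, self_mem_nhdsWithin]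
      with x hx1 hx2 hx3
    exact ⟨_, hx1, hemisphereGraph_orthogonalProjectionOnto hu
      (mem_sphere_zero_iff_norm.mp hx3) hx2.le⟩
  · refine ((hC.mono inter_subset_left).hausdorffMeasure_image_le d.cast_nonneg).trans_lt ?_
    refine ENNReal.mul_lt_top (by simp) ?_
    exact (measure_mono inter_subset_right).trans_lt (isCompact_closedBall _ _).measure_lt_top

theorem hausdorffMeasure_sphere_inter_pos (hd : Module.finrank ℝ E = d + 1) {U : Set E}
    (hU : IsOpen U) {u : E} (hu : ‖u‖ = 1) (huU : u ∈ U) :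
    0 < μH[(d : ℝ)] (sphere (0 : E) 1 ∩ U) := by
  have := isAddHaarMeasure_hausdorffMeasure_orthogonal hd hu
  have hmem : closedBall 0 1 ∩ hemisphereGraph u ⁻¹' U ∈ 𝓝 (0 : (ℝ ∙ u)ᗮ) :=
    inter_mem (closedBall_mem_nhds _ one_pos)
      ((hU.preimage (continuous_hemisphereGraph u)).mem_nhds
        (by rwa [mem_preimage, hemisphereGraph_zero]))
  refine (Measure.measure_pos_of_mem_nhds μH[(d : ℝ)] hmem).trans_le
    (le_trans (measure_mono ?_)
      (hausdorffMeasure_orthogonalProjectionOnto_le (ℝ ∙ u)ᗮ d _ d.cast_nonneg))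
  rintro y ⟨hy, hyU⟩
  exact ⟨hemisphereGraph u y,
    ⟨hemisphereGraph_mem_sphere hu (mem_closedBall_zero_iff.mp hy), hyU⟩,
    orthogonalProjectionOnto_add_smul u y _⟩

/-- A continuous function on the sphere with the same distribution as a constant is constant. -/
theorem eq_const_of_hausdorffMeasure_sphere_eq (hd : Module.finrank ℝ E = d + 1) {f : E → ℝ}
    (hf : Continuous f) {c : ℝ} (hc : 0 ≤ c)
    (h : ∀ t, 0 ≤ t → μH[(d : ℝ)] ({x | t ≤ f x} ∩ sphere (0 : E) 1) =
      μH[(d : ℝ)] ({_x | t ≤ c} ∩ sphere (0 : E) 1)) {u : E} (hu : ‖u‖ = 1) : f u = c := by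
  refine le_antisymm (le_of_not_gt fun hlt => ?_) (le_of_not_gt fun hlt => ?_)
  · obtain ⟨t, ht1, ht2⟩ := exists_between hlt
    have h1 := h t (hc.trans ht1.le)
    have h2 := hausdorffMeasure_sphere_inter_pos hd (isOpen_lt continuous_const hf) hu ht2
    have h3 : {_x : E | t ≤ c} = ∅ := by
      ext x; simpa using ht1
    rw [h3, empty_inter, measure_empty] at h1
    refine h2.ne' (measure_mono_null ?_ h1)
    exact fun x hx => ⟨le_of_lt (show t < f x from hx.2), hx.1⟩
  · have h1 := h c hc
    have h2 := hausdorffMeasure_sphere_inter_pos hd (isOpen_lt hf continuous_const) hu hlt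
    have h3 : {_x : E | c ≤ c} = univ := by
      ext x; simp
    rw [h3, univ_inter] at h1
    have h4 := measure_inter_add_sdiff (μ := μH[(d : ℝ)]) (sphere (0 : E) 1)
      (isClosed_le continuous_const hf : IsClosed {x | c ≤ f x}).measurableSet
    rw [inter_comm, h1] at h4
    have h5 := hausdorffMeasure_sphere_lt_top hd
    have h6 := (ENNReal.add_right_inj h5.ne).mp (h4.trans (add_zero _).symm)
    refine h2.ne' (measure_mono_null ?_ h6)
    exact fun x hx => ⟨hx.1, not_le_of_gt (show f x < c from hx.2)⟩

end Sphere

section Projections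

open Filter Topology Pointwise

variable {d : ℕ}

theorem exists_projVol_eq (d : ℕ) : ∃ a : ℝ, 0 < a ∧ ∀ (A : Set (Euc (d + 1))), IsCompact A →
    ∀ u, ‖u‖ = 1 → projVol (d + 1) A u = ENNReal.ofReal (a * volume.real (shadow A u)) := by
  set b := Measure.addHaarScalarFactor (volume : Measure (EuclideanSpace ℝ (Fin d))) μH[d] with hb
  have hb0 : b ≠ 0 := Measure.addHaarScalarFactor_volume_hausdorffMeasure_ne_zero d
  refine ⟨(b : ℝ)⁻¹, by positivity, fun A hA u hu => ?_⟩
  have hfr : Module.finrank ℝ (Euc (d + 1)) = d + 1 := by simp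
  have : Fact (Module.finrank ℝ (Euc (d + 1)) = d + 1) := ⟨hfr⟩
  have hu0 : u ≠ 0 := by
    rintro rfl; simp at hu
  have h1 : (fun x => x - ⟪x, u⟫ • u) '' A = Subtype.val '' shadow A u := by
    rw [shadow_eq_image A hu, image_image]
    refine image_congr fun x _ => ?_
    rw [sub_eq_iff_eq_add, orthogonalProjectionOnto_add_inner_smul hu]
  have h2 : volume (shadow A u) = b * μH[(d : ℝ)] (shadow A u) := by
    rw [← InnerProductSpace.euclideanHausdorffMeasure_eq_volume,
      Submodule.finrank_orthogonal_span_singleton (n := d) hu0,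
      Measure.euclideanHausdorffMeasure_def]
    rfl
  have h3 : volume (shadow A u) ≠ ∞ := (hA.shadow hu).measure_lt_top.ne
  rw [projVol, h1, isometry_subtype_coe.hausdorffMeasure_image (Or.inl (by push_cast; simp)),
    ENNReal.ofReal_mul (by positivity), ofReal_measureReal h3, h2, ENNReal.ofReal_inv_of_pos
    (by positivity), ENNReal.ofReal_coe_nnreal, ← mul_assoc, ENNReal.inv_mul_cancel
    (by exact_mod_cast hb0) ENNReal.coe_ne_top, one_mul]
  congr 2
  push_cast; ring

theorem exists_volume_shadow_closedBall (hd : 1 ≤ d) : ∃ ω : ℝ, 0 < ω ∧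
    ∀ (u : Euc (d + 1)), ‖u‖ = 1 → ∀ r, 0 ≤ r →
      volume.real (shadow (closedBall 0 r) u) = ω * r ^ d := by
  refine ⟨√Real.pi ^ d / Real.Gamma (d / 2 + 1), ?_, fun u hu r hr => ?_⟩
  · have : 0 < Real.Gamma (d / 2 + 1) := Real.Gamma_pos_of_pos (by positivity)
    positivity
  have hfr : Module.finrank ℝ (Euc (d + 1)) = d + 1 := by simp
  have : Fact (Module.finrank ℝ (Euc (d + 1)) = d + 1) := ⟨hfr⟩
  have hu0 : u ≠ 0 := by
    rintro rfl; simp at hu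
  have h1 : shadow (closedBall 0 r) u = closedBall 0 r := by
    rw [shadow_eq_image _ hu]
    refine Subset.antisymm ?_ fun y hy => ?_
    · rintro _ ⟨x, hx, rfl⟩
      rw [mem_closedBall_zero_iff] at hx ⊢
      exact (Submodule.norm_orthogonalProjectionOnto_apply_le _ _).trans hx
    · refine ⟨y, ?_, Submodule.orthogonalProjectionOnto_mem_subspace_eq_self y⟩
      rw [mem_closedBall_zero_iff] at hy ⊢
      exact hy
  have h2 := Submodule.finrank_orthogonal_span_singleton (𝕜 := ℝ) (n := d) hu0
  have : Nontrivial (ℝ ∙ u)ᗮ := Module.nontrivial_of_finrank_pos (R := ℝ) (by rw [h2]; lia)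
  rw [h1, Measure.real, InnerProductSpace.volume_closedBall, h2, ENNReal.toReal_mul,
    ENNReal.toReal_pow, ENNReal.toReal_ofReal hr, ENNReal.toReal_ofReal (by positivity), mul_comm]

theorem IsSymmBody.continuous_integral_abs_inner {E : Type*} [NormedAddCommGroup E]
    [InnerProductSpace ℝ E] [FiniteDimensional ℝ E] [MeasurableSpace E] [BorelSpace E] {K : Set E}
    (hK : IsSymmBody K) : Continuous fun u => ∫ x in K, |⟪u, gradient (gauge K) x⟫| := by
  obtain ⟨M, hM⟩ := hK.exists_norm_gradient_gauge_le
  have hG : Measurable (gradient (gauge K)) := measurable_gradient_real _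
  rw [continuous_iff_continuousAt]
  intro u
  refine continuousAt_of_dominated (bound := fun _ => (‖u‖ + 1) * M) ?_ ?_ ?_ ?_
  · refine .of_forall fun v => Measurable.aestronglyMeasurable ?_
    fun_prop
  · filter_upwards [continuous_norm.continuousAt.eventually_lt continuousAt_const
      (show ‖u‖ < ‖u‖ + 1 by linarith)] with v hv
    refine .of_forall fun x => ?_
    rw [norm_abs_eq_norm]
    exact (abs_real_inner_le_norm _ _).trans
      (mul_le_mul hv.le (hM x) (norm_nonneg _) (by positivity))
  · exact integrableOn_const hK.isCompact.measure_lt_top.ne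
  · refine .of_forall fun x => Continuous.continuousAt ?_
    fun_prop

theorem IsConvexBody.isSymmBody {n : ℕ} {K : Set (Euc n)} (hK : IsConvexBody K) (hKs : K = -K) :
    IsSymmBody K := by
  have hneg : ∀ x ∈ K, -x ∈ K := fun x hx => by
    rw [hKs] at hx; exact hx
  obtain ⟨hconv, hcomp, x, hx⟩ := hK
  refine ⟨hconv, hcomp, hneg, ?_⟩
  rw [← mem_interior_iff_mem_nhds]
  have h := hconv.combo_interior_self_mem_interior hx (hneg x (interior_subset hx))
    (by norm_num : (0 : ℝ) < 1 / 2) (by norm_num : (0 : ℝ) ≤ 1 / 2) (by norm_num)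
  simpa using h

end Projections

/-- An origin-symmetric convex body in `ℝⁿ` whose projections have the
same distribution function as those of a centered ball of radius `r` is that ball. -/
theorem stmt_8 (n : ℕ) (hn : 2 ≤ n) (K : Set (Euc n))
    (hK : IsConvexBody K) (hKsym : K = -K) (r : ℝ) (hr : 0 < r)
    (h : ∀ t : ℝ, 0 ≤ t → PiDist n K t = PiDist n (closedBall (0 : Euc n) r) t) :
    K = closedBall (0 : Euc n) r := by
  obtain ⟨d, rfl⟩ : ∃ d, n = d + 1 := ⟨n - 1, by lia⟩
  have hfr : Module.finrank ℝ (Euc (d + 1)) = d + 1 := by simp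
  have hS := hK.isSymmBody hKsym
  obtain ⟨a, ha, hproj⟩ := exists_projVol_eq d
  obtain ⟨ω, hω, hball⟩ := exists_volume_shadow_closedBall (d := d) (by lia)
  set Φ : Euc (d + 1) → ℝ := fun u =>
    a * ((d + 1) / 2 * ∫ x in K, |⟪u, gradient (gauge K) x⟫|) with hΦ
  have hΦc : Continuous Φ := by
    have := hS.continuous_integral_abs_inner
    fun_prop
  have hΦs (u : Euc (d + 1)) (hu : ‖u‖ = 1) : Φ u = a * volume.real (shadow K u) := by
    simp only [hΦ, hS.integral_abs_inner_gradient hfr hu]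
    field_simp
  have hc0 : 0 ≤ a * (ω * r ^ d) := by positivity
  have hdim : ((d + 1 : ℕ) : ℝ) - 1 = d := by push_cast; ring
  have hlt := hausdorffMeasure_sphere_lt_top hfr
  have hpos : μH[(d : ℝ)] (sphere (0 : Euc (d + 1)) 1) ≠ 0 := by
    have : Nontrivial (Euc (d + 1)) := Module.nontrivial_of_finrank_pos (R := ℝ) (by simp)
    obtain ⟨e, he⟩ := exists_norm_eq (Euc (d + 1)) (zero_le_one : (0 : ℝ) ≤ 1)
    simpa using (hausdorffMeasure_sphere_inter_pos hfr isOpen_univ he (mem_univ e)).ne'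
  have hdist (t : ℝ) (ht : 0 ≤ t) : μH[(d : ℝ)] ({u | t ≤ Φ u} ∩ sphere 0 1) =
      μH[(d : ℝ)] ({_u | t ≤ a * (ω * r ^ d)} ∩ sphere (0 : Euc (d + 1)) 1) := by
    have h1 := h t ht
    rw [PiDist, PiDist, sphHaar, sphHaar, hdim, ENNReal.div_eq_div_iff hpos hlt.ne hpos hlt.ne,
      ENNReal.mul_right_inj hpos hlt.ne] at h1
    convert h1 using 2
    · ext u
      refine and_congr_left fun hu => ?_
      rw [mem_sphere_zero_iff_norm] at hu
      rw [mem_ofPred_eq, mem_ofPred_eq, hproj K hK.2.1 u hu, hΦs u hu,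
        ENNReal.ofReal_le_ofReal_iff (by positivity)]
    · ext u
      refine and_congr_left fun hu => ?_
      rw [mem_sphere_zero_iff_norm] at hu
      rw [mem_ofPred_eq, mem_ofPred_eq, hproj _ (isCompact_closedBall _ _) u hu,
        hball u hu r hr.le, ENNReal.ofReal_le_ofReal_iff hc0]
  have hconst (u : Euc (d + 1)) (hu : ‖u‖ = 1) : volume.real (shadow K u) = ω * r ^ d := by
    have := eq_const_of_hausdorffMeasure_sphere_eq hfr hΦc hc0 hdist hu
    rw [hΦs u hu] at this
    exact mul_left_cancel₀ ha.ne' this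
  obtain ⟨R, hR, rfl⟩ := hS.exists_eq_closedBall hfr (by lia) hconst
  have : Nontrivial (Euc (d + 1)) := Module.nontrivial_of_finrank_pos (R := ℝ) (by simp)
  obtain ⟨e, he⟩ := exists_norm_eq (Euc (d + 1)) (zero_le_one : (0 : ℝ) ≤ 1)
  have := hconst e he
  rw [hball e he R hR] at this
  rw [(pow_left_inj₀ hR hr.le (by lia)).mp (mul_left_cancel₀ hω.ne' this)]
end
end

section
/- Let L be an origin-symmetric convex body in R^2 and r > 0. If Π_{rB₂²}(t) ≤ Π_L(t) for all t ≥ 0, then |rB₂²| ≤ |L| (i.e. πr² ≤ |L|); and if Π_{rB₂²}(t) ≥ Π_L(t) for all t ≥ 0, then |rB₂²| ≥ |L| (i.e. πr² ≥ |L|). -/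
open MeasureTheory Metric Set
open scoped RealInnerProductSpace ENNReal NNReal

noncomputable section

/-- Rotation of the plane by a right angle. -/
def quarterTurn (x : Euc 2) : Euc 2 := !₂[-x 1, x 0]

lemma inner_euc_two (x y : Euc 2) : ⟪x, y⟫ = x 0 * y 0 + x 1 * y 1 := by
  simp [EuclideanSpace.inner_eq_star_dotProduct, Matrix.vec2_dotProduct, mul_comm]

lemma norm_sq_euc_two (x : Euc 2) : ‖x‖ ^ 2 = x 0 ^ 2 + x 1 ^ 2 := by
  rw [← real_inner_self_eq_norm_sq, inner_euc_two]; ring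

@[simp] lemma quarterTurn_apply_zero (x : Euc 2) : quarterTurn x 0 = -x 1 := rfl

@[simp] lemma quarterTurn_apply_one (x : Euc 2) : quarterTurn x 1 = x 0 := rfl

lemma norm_quarterTurn (x : Euc 2) : ‖quarterTurn x‖ = ‖x‖ := by
  rw [← sq_eq_sq₀ (norm_nonneg _) (norm_nonneg _), norm_sq_euc_two, norm_sq_euc_two]
  simp; ring

lemma quarterTurn_neg_quarterTurn (x : Euc 2) : quarterTurn (-quarterTurn x) = x := by
  ext i; fin_cases i <;> simp

lemma continuous_quarterTurn : Continuous quarterTurn := by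
  unfold quarterTurn
  fun_prop

lemma sub_inner_smul_eq_quarterTurn {θ : Euc 2} (hθ : ‖θ‖ = 1) (x : Euc 2) :
    x - ⟪x, θ⟫ • θ = ⟪x, quarterTurn θ⟫ • quarterTurn θ := by
  have h := norm_sq_euc_two θ
  rw [hθ] at h
  ext i; fin_cases i
  · simp [inner_euc_two]; linear_combination x 0 * h
  · simp [inner_euc_two]; linear_combination x 1 * h

/-- The projection of a planar set has the length of the set of its coordinates along the
projection line. -/
lemma projVol_two (K : Set (Euc 2)) {θ : Euc 2} (hθ : ‖θ‖ = 1) :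
    projVol 2 K θ = volume ((fun x => ⟪x, quarterTurn θ⟫) '' K) := by
  have hiso : Isometry (fun s : ℝ => s • quarterTurn θ) := by
    refine Isometry.of_dist_eq fun a b => ?_
    rw [dist_eq_norm, ← sub_smul, norm_smul, norm_quarterTurn, hθ, mul_one, dist_eq_norm]
  have himage : (fun x => x - ⟪x, θ⟫ • θ) '' K =
      (fun s : ℝ => s • quarterTurn θ) '' ((fun x => ⟪x, quarterTurn θ⟫) '' K) := by
    rw [image_image]
    exact image_congr fun x _ => sub_inner_smul_eq_quarterTurn hθ x
  have hdim : ((2 : ℕ) : ℝ) - 1 = 1 := by norm_num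
  rw [projVol, himage, hdim, hiso.hausdorffMeasure_image (Or.inl zero_le_one),
    hausdorffMeasure_real]

lemma projVol_two_le {K : Set (Euc 2)} {θ : Euc 2} (hθ : ‖θ‖ = 1) {c : ℝ}
    (h : ∀ x ∈ K, |⟪x, quarterTurn θ⟫| ≤ c) : projVol 2 K θ ≤ ENNReal.ofReal (2 * c) := by
  rw [projVol_two K hθ]
  have hsub : (fun x => ⟪x, quarterTurn θ⟫) '' K ⊆ Icc (-c) c := by
    rintro _ ⟨x, hx, rfl⟩
    exact abs_le.1 (h x hx)
  refine (measure_mono hsub).trans_eq ?_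
  rw [Real.volume_Icc]
  ring_nf

lemma le_projVol_two {K : Set (Euc 2)} (hK : Convex ℝ K) (hsymm : ∀ x ∈ K, -x ∈ K)
    {θ : Euc 2} (hθ : ‖θ‖ = 1) {x : Euc 2} (hx : x ∈ K) :
    ENNReal.ofReal (2 * ⟪x, quarterTurn θ⟫) ≤ projVol 2 K θ := by
  rw [projVol_two K hθ]
  have hconv : Convex ℝ ((fun x => ⟪x, quarterTurn θ⟫) '' K) :=
    hK.is_linear_image
      ⟨fun a b => inner_add_left a b _, fun c a => real_inner_smul_left a _ c⟩
  have hsub : Icc (-⟪x, quarterTurn θ⟫) ⟪x, quarterTurn θ⟫ ⊆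
      (fun x => ⟪x, quarterTurn θ⟫) '' K :=
    hconv.ordConnected.out ⟨-x, hsymm x hx, inner_neg_left _ _⟩ ⟨x, hx, rfl⟩
  refine le_trans (le_of_eq ?_) (measure_mono hsub)
  rw [Real.volume_Icc]
  ring_nf

lemma projVol_closedBall {θ : Euc 2} (hθ : ‖θ‖ = 1) {r : ℝ} (hr : 0 ≤ r) :
    projVol 2 (closedBall (0 : Euc 2) r) θ = ENNReal.ofReal (2 * r) := by
  have hη : ‖quarterTurn θ‖ = 1 := (norm_quarterTurn θ).trans hθ
  apply le_antisymm
  · refine projVol_two_le hθ fun x hx => (abs_real_inner_le_norm _ _).trans ?_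
    rw [hη, mul_one]
    exact mem_closedBall_zero_iff.1 hx
  · have hmem : r • quarterTurn θ ∈ closedBall (0 : Euc 2) r := by
      rw [mem_closedBall_zero_iff, norm_smul, hη, mul_one, Real.norm_of_nonneg hr]
    have h := le_projVol_two (convex_closedBall (0 : Euc 2) r)
      (fun x hx => by simpa using hx) hθ hmem
    rwa [real_inner_smul_left, real_inner_self_eq_norm_sq, hη, one_pow, mul_one] at h

lemma hausdorffMeasure_circle_lt_top : μH[1] (sphere (0 : Euc 2) 1) < ∞ := by
  have hlip : LipschitzWith 1 (fun φ : ℝ => (!₂[Real.cos φ, Real.sin φ] : Euc 2)) := by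
    refine LipschitzWith.of_dist_le_mul fun a b => ?_
    rw [NNReal.coe_one, one_mul, dist_eq_norm, Real.dist_eq,
      ← sq_le_sq₀ (norm_nonneg _) (abs_nonneg _), norm_sq_euc_two, sq_abs]
    have h := Real.one_sub_sq_div_two_le_cos (x := a - b)
    rw [Real.cos_sub] at h
    simp
    nlinarith [Real.sin_sq_add_cos_sq a, Real.sin_sq_add_cos_sq b]
  have hsub : sphere (0 : Euc 2) 1 ⊆
      (fun φ : ℝ => (!₂[Real.cos φ, Real.sin φ] : Euc 2)) '' Icc (-Real.pi) Real.pi := by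
    intro x hx
    have h := norm_sq_euc_two x
    rw [mem_sphere_zero_iff_norm.1 hx] at h
    have hz : ‖(⟨x 0, x 1⟩ : ℂ)‖ = 1 := by
      rw [← sq_eq_sq₀ (norm_nonneg _) zero_le_one, Complex.sq_norm, Complex.normSq_mk]
      linarith
    have hz0 : (⟨x 0, x 1⟩ : ℂ) ≠ 0 := by
      rw [← norm_ne_zero_iff, hz]; exact one_ne_zero
    refine ⟨Complex.arg ⟨x 0, x 1⟩,
      ⟨(Complex.neg_pi_lt_arg _).le, Complex.arg_le_pi _⟩, ?_⟩
    ext i; fin_cases i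
    · simp [Complex.cos_arg hz0, hz]
    · simp [Complex.sin_arg, hz]
  refine (measure_mono hsub).trans_lt ((hlip.hausdorffMeasure_image_le zero_le_one _).trans_lt ?_)
  rw [hausdorffMeasure_real]
  simp

/-- Nonempty relatively open subsets of the circle have positive length. -/
lemma hausdorffMeasure_open_inter_circle_pos {U : Set (Euc 2)} (hU : IsOpen U) {θ : Euc 2}
    (hθU : θ ∈ U) (hθ : ‖θ‖ = 1) : 0 < μH[1] (U ∩ sphere (0 : Euc 2) 1) := by
  set η := quarterTurn θ with hη_def
  have hη : ‖η‖ = 1 := (norm_quarterTurn θ).trans hθ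
  have hθη : ⟪θ, η⟫ = 0 := by
    rw [inner_euc_two, hη_def]; simp; ring
  have hlip : LipschitzWith 1 (fun x : Euc 2 => ⟪x, η⟫) := by
    refine LipschitzWith.of_dist_le_mul fun a b => ?_
    rw [Real.dist_eq, ← inner_sub_left, NNReal.coe_one, one_mul, dist_eq_norm]
    simpa [hη] using abs_real_inner_le_norm (a - b) η
  have hcont : Continuous fun s : ℝ => √(1 - s ^ 2) • θ + s • η := by fun_prop
  have hnhds : {s : ℝ | √(1 - s ^ 2) • θ + s • η ∈ U ∧ s ^ 2 < 1} ∈ nhds (0 : ℝ) := by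
    refine Filter.inter_mem (hcont.continuousAt.preimage_mem_nhds ?_) ?_
    · exact hU.mem_nhds (by simpa using hθU)
    · exact (isOpen_lt (continuous_pow 2) continuous_const).mem_nhds (by simp)
  have hsub : {s : ℝ | √(1 - s ^ 2) • θ + s • η ∈ U ∧ s ^ 2 < 1} ⊆
      (fun x : Euc 2 => ⟪x, η⟫) '' (U ∩ sphere (0 : Euc 2) 1) := by
    rintro s ⟨hsU, hs⟩
    refine ⟨_, ⟨hsU, ?_⟩, ?_⟩
    · rw [mem_sphere_zero_iff_norm, ← sq_eq_sq₀ (norm_nonneg _) zero_le_one,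
        norm_add_sq_real, real_inner_smul_left, real_inner_smul_right, hθη, norm_smul, norm_smul,
        hθ, hη, mul_one, mul_one, Real.norm_eq_abs, Real.norm_eq_abs, sq_abs, sq_abs,
        Real.sq_sqrt (by linarith)]
      ring
    · simp only [inner_add_left, real_inner_smul_left, hθη, real_inner_self_eq_norm_sq, hη]
      ring
  have hpos := (MeasureTheory.Measure.measure_pos_of_mem_nhds volume hnhds).trans_le (measure_mono hsub)
  rw [← hausdorffMeasure_real] at hpos
  simpa using hpos.trans_le (hlip.hausdorffMeasure_image_le zero_le_one _)

lemma hausdorffMeasure_circle_pos : 0 < μH[1] (sphere (0 : Euc 2) 1) := by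
  have h := hausdorffMeasure_open_inter_circle_pos isOpen_univ
    (mem_univ (EuclideanSpace.single 0 1 : Euc 2)) (by simp)
  rwa [univ_inter] at h

lemma sphHaar_two (A : Set (Euc 2)) :
    sphHaar 2 A = μH[1] (A ∩ sphere (0 : Euc 2) 1) / μH[1] (sphere (0 : Euc 2) 1) := by
  have hdim : ((2 : ℕ) : ℝ) - 1 = 1 := by norm_num
  rw [sphHaar, hdim]

lemma sphHaar_two_eq_one {A : Set (Euc 2)} (h : ∀ θ : Euc 2, ‖θ‖ = 1 → θ ∈ A) :
    sphHaar 2 A = 1 := by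
  rw [sphHaar_two, inter_eq_right.2 fun θ hθ => h θ (mem_sphere_zero_iff_norm.1 hθ)]
  exact ENNReal.div_self hausdorffMeasure_circle_pos.ne' hausdorffMeasure_circle_lt_top.ne

lemma sphHaar_two_eq_zero {A : Set (Euc 2)} (h : ∀ θ : Euc 2, ‖θ‖ = 1 → θ ∉ A) :
    sphHaar 2 A = 0 := by
  have hempty : A ∩ sphere (0 : Euc 2) 1 = ∅ :=
    eq_empty_of_forall_notMem fun θ hθ => h θ (mem_sphere_zero_iff_norm.1 hθ.2) hθ.1
  rw [sphHaar_two, hempty, measure_empty, ENNReal.zero_div]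

lemma sphHaar_two_pos {A U : Set (Euc 2)} (hU : IsOpen U)
    (hUA : ∀ θ ∈ U, ‖θ‖ = 1 → θ ∈ A) {θ : Euc 2} (hθU : θ ∈ U) (hθ : ‖θ‖ = 1) :
    0 < sphHaar 2 A := by
  rw [sphHaar_two]
  refine ENNReal.div_pos (ne_of_gt ?_) hausdorffMeasure_circle_lt_top.ne
  exact (hausdorffMeasure_open_inter_circle_pos hU hθU hθ).trans_le
    (measure_mono fun x hx => ⟨hUA x hx.1 (mem_sphere_zero_iff_norm.1 hx.2), hx.2⟩)

lemma sphHaar_two_lt_one {A U : Set (Euc 2)} (hU : IsOpen U)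
    (hUA : ∀ θ ∈ U, ‖θ‖ = 1 → θ ∉ A) {θ : Euc 2} (hθU : θ ∈ U) (hθ : ‖θ‖ = 1) :
    sphHaar 2 A < 1 := by
  have hsub : A ∩ sphere (0 : Euc 2) 1 ⊆ sphere (0 : Euc 2) 1 \ U := fun x hx =>
    ⟨hx.2, fun hxU => hUA x hxU (mem_sphere_zero_iff_norm.1 hx.2) hx.1⟩
  have hpos := hausdorffMeasure_open_inter_circle_pos hU hθU hθ
  have hsplit := measure_inter_add_sdiff (μ := μH[1]) (sphere (0 : Euc 2) 1) hU.measurableSet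
  rw [inter_comm] at hsplit
  rw [sphHaar_two]
  refine ENNReal.div_lt_of_lt_mul ?_
  rw [one_mul, ← hsplit, add_comm]
  refine (measure_mono hsub).trans_lt (ENNReal.lt_add_right ?_ hpos.ne')
  exact ((measure_mono sdiff_subset).trans_lt hausdorffMeasure_circle_lt_top).ne

lemma PiDist_closedBall_eq_one {r : ℝ} (hr : 0 ≤ r) :
    PiDist 2 (closedBall (0 : Euc 2) r) (2 * r) = 1 :=
  sphHaar_two_eq_one fun _ hθ => (projVol_closedBall hθ hr).ge

lemma PiDist_closedBall_eq_zero {r s : ℝ} (hr : 0 ≤ r) (hs : r < s) :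
    PiDist 2 (closedBall (0 : Euc 2) r) (2 * s) = 0 := by
  refine sphHaar_two_eq_zero fun θ hθ => ?_
  rw [mem_ofPred_eq, projVol_closedBall hθ hr, not_le]
  exact (ENNReal.ofReal_lt_ofReal_iff (by linarith)).2 (by linarith)

/-- A point outside a symmetric closed convex set lies beyond a supporting strip. -/
lemma exists_unit_abs_inner_le_of_notMem {E : Type*} [NormedAddCommGroup E]
    [InnerProductSpace ℝ E] [CompleteSpace E] {K : Set E} (hK : Convex ℝ K) (hclosed : IsClosed K)
    (hne : K.Nonempty) (hsymm : ∀ x ∈ K, -x ∈ K) {x : E} (hx : x ∉ K) :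
    ∃ (η : E) (c : ℝ), ‖η‖ = 1 ∧ c < ‖x‖ ∧ ∀ y ∈ K, |⟪y, η⟫| ≤ c := by
  obtain ⟨f, u, hfu, hux⟩ := geometric_hahn_banach_closed_point hK hclosed hx
  set p := (InnerProductSpace.toDual ℝ E).symm f with hp_def
  have hf : ∀ y, ⟪y, p⟫ = f y := fun y => by
    rw [real_inner_comm, hp_def, InnerProductSpace.toDual_symm_apply]
  have hp : 0 < ‖p‖ := by
    rw [norm_pos_iff]
    intro h0
    obtain ⟨a, ha⟩ := hne
    have h1 := hfu a ha
    rw [← hf, h0, inner_zero_right] at h1 hux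
    exact h1.not_gt hux
  refine ⟨‖p‖⁻¹ • p, ‖p‖⁻¹ * u, norm_smul_inv_norm (norm_pos_iff.1 hp), ?_, fun y hy => ?_⟩
  · rw [inv_mul_lt_iff₀ hp, mul_comm]
    rw [← hf] at hux
    exact hux.trans_le (real_inner_le_norm _ _)
  · rw [real_inner_smul_right, abs_mul, abs_of_pos (inv_pos.2 hp), hf]
    refine mul_le_mul_of_nonneg_left (abs_le.2 ⟨?_, (hfu y hy).le⟩) (inv_pos.2 hp).le
    have h := hfu _ (hsymm y hy)
    rw [map_neg] at h
    linarith

lemma closedBall_subset_of_one_le_PiDist {L : Set (Euc 2)} (hconv : Convex ℝ L)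
    (hcpt : IsCompact L) (hne : L.Nonempty) (hsymm : ∀ x ∈ L, -x ∈ L) {r : ℝ} (hr : 0 < r)
    (h : 1 ≤ PiDist 2 L (2 * r)) : closedBall (0 : Euc 2) r ⊆ L := by
  intro x hx
  by_contra hxL
  obtain ⟨η, c, hη, hcx, hc⟩ :=
    exists_unit_abs_inner_le_of_notMem hconv hcpt.isClosed hne hsymm hxL
  have hcr : c < r := hcx.trans_le (mem_closedBall_zero_iff.1 hx)
  obtain ⟨R, hR⟩ := hcpt.isBounded.exists_norm_le
  refine h.not_gt (sphHaar_two_lt_one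
    (U := {θ | R * ‖quarterTurn θ - η‖ < (r - c) / 2}) (θ := -quarterTurn η) ?_ ?_ ?_ ?_)
  · have := continuous_quarterTurn
    exact isOpen_lt (by fun_prop) continuous_const
  · intro θ hθU hθ
    rw [mem_ofPred_eq, not_le]
    refine (projVol_two_le hθ (c := (c + r) / 2) fun y hy => ?_).trans_lt
      ((ENNReal.ofReal_lt_ofReal_iff (by linarith)).2 (by linarith))
    have hle : |⟪y, quarterTurn θ - η⟫| ≤ R * ‖quarterTurn θ - η‖ :=
      (abs_real_inner_le_norm _ _).trans
        (mul_le_mul_of_nonneg_right (hR y hy) (norm_nonneg _))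
    have hsplit : ⟪y, quarterTurn θ⟫ = ⟪y, η⟫ + ⟪y, quarterTurn θ - η⟫ := by
      rw [← inner_add_right, add_sub_cancel]
    rw [mem_ofPred_eq] at hθU
    rw [hsplit]
    linarith [abs_add_le ⟪y, η⟫ ⟪y, quarterTurn θ - η⟫, hc y hy]
  · rw [mem_ofPred_eq, quarterTurn_neg_quarterTurn, sub_self, norm_zero, mul_zero]
    linarith
  · rw [norm_neg, norm_quarterTurn, hη]

lemma subset_closedBall_of_PiDist_eq_zero {L : Set (Euc 2)} (hconv : Convex ℝ L)
    (hsymm : ∀ x ∈ L, -x ∈ L) {r : ℝ} (hr : 0 < r)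
    (h : ∀ s, r < s → PiDist 2 L (2 * s) = 0) : L ⊆ closedBall (0 : Euc 2) r := by
  intro x hx
  by_contra hxr
  rw [mem_closedBall_zero_iff, not_le] at hxr
  obtain ⟨s, hrs, hsx⟩ := exists_between hxr
  have hx0 : 0 < ‖x‖ := hr.trans hxr
  have hη : ‖‖x‖⁻¹ • x‖ = 1 := norm_smul_inv_norm (norm_pos_iff.1 hx0)
  refine (sphHaar_two_pos (U := {θ | s < ⟪x, quarterTurn θ⟫})
    (θ := -quarterTurn (‖x‖⁻¹ • x)) ?_ ?_ ?_ ?_).ne' (h s hrs)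
  · have := continuous_quarterTurn
    exact isOpen_lt continuous_const (by fun_prop)
  · intro θ hθU hθ
    rw [mem_ofPred_eq] at hθU
    exact (ENNReal.ofReal_le_ofReal (by linarith)).trans (le_projVol_two hconv hsymm hθ hx)
  · rw [mem_ofPred_eq, quarterTurn_neg_quarterTurn, real_inner_smul_right,
      real_inner_self_eq_norm_sq, sq, inv_mul_cancel_left₀ hx0.ne']
    exact hsx
  · rw [norm_neg, norm_quarterTurn, hη]

/-- Comparison of areas with a disk via the distribution function of
projections in `ℝ²`. -/
theorem stmt_9 (L : Set (Euc 2)) (hL : IsConvexBody L) (hLsym : L = -L)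
    (r : ℝ) (hr : 0 < r) :
    ((∀ t : ℝ, 0 ≤ t → PiDist 2 (closedBall (0 : Euc 2) r) t ≤ PiDist 2 L t) →
      volume (closedBall (0 : Euc 2) r) ≤ volume L) ∧
    ((∀ t : ℝ, 0 ≤ t → PiDist 2 L t ≤ PiDist 2 (closedBall (0 : Euc 2) r) t) →
      volume L ≤ volume (closedBall (0 : Euc 2) r)) := by
  obtain ⟨hconv, hcpt, hint⟩ := hL
  have hsymm : ∀ x ∈ L, -x ∈ L := fun x hx => by
    rw [hLsym] at hx
    exact hx
  refine ⟨fun h => measure_mono ?_, fun h => measure_mono ?_⟩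
  · refine closedBall_subset_of_one_le_PiDist hconv hcpt (hint.mono interior_subset) hsymm hr ?_
    exact (PiDist_closedBall_eq_one hr.le).ge.trans (h _ (by linarith))
  · refine subset_closedBall_of_PiDist_eq_zero hconv hsymm hr fun s hs => ?_
    exact le_antisymm ((h _ (by linarith)).trans (PiDist_closedBall_eq_zero hr.le hs).le)
      zero_le
end
end
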